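/- Let d ≥ 5. Let V₁, V₂ be continuous real functions on ℝ^d satisfying |V_j(x)| ≤ C₀(1+|x|²)^{−β/2} on ℝ^d for some β > d−2 and C₀ > 0 (j = 1,2). Assume that for j = 1,2 the functional Q_{V_j} is critical in ℝ^d. Then there exists r₀ > 0 such that for every R ∈ ℝ^d with |R| ≥ r₀ the functional Q_{V₁ + V₂^R} is supercritical (i.e., Q_{V₁+V₂^R}(u) < 0 for some u ∈ C_c^∞(ℝ^d)); moreover, there exists a constant C > 0 such that −C|R|^{2−d} ≤ E(R) ≤ −C^{−1}|R|^{2−d} for all |R| ≥ r₀. -/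

import Mathlib

open MeasureTheory Filter
open scoped Topology

noncomputable section

abbrev Ed (d : ℕ) := EuclideanSpace ℝ (Fin d)

/-- A smooth compactly supported test function on ℝ^d. -/
def IsTest {d : ℕ} (u : Ed d → ℝ) : Prop :=
  ContDiff ℝ (⊤ : ℕ∞) u ∧ HasCompactSupport u

/-- The quadratic functional `Q_V(u) = ∫ (|∇u|² + V u²) dx`. -/
def Qf {d : ℕ} (V : Ed d → ℝ) (u : Ed d → ℝ) : ℝ :=
  ∫ x, (‖gradient u x‖ ^ 2 + V x * u x ^ 2)

/-- `Q_V` is supercritical in ℝ^d: `Q_V(u) < 0` for some test function `u`. -/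
def Supercrit {d : ℕ} (V : Ed d → ℝ) : Prop :=
  ∃ u, IsTest u ∧ Qf V u < 0

/-- A null sequence for `Q_V`. -/
def NullSeq {d : ℕ} (V : Ed d → ℝ) (un : ℕ → Ed d → ℝ) : Prop :=
  (∀ n, IsTest (un n)) ∧ (∀ n x, 0 ≤ un n x) ∧
  (∃ B : Set (Ed d), IsOpen B ∧ Bornology.IsBounded B ∧
    ∀ n, (∫ x in B, un n x ^ 2) = 1) ∧
  Tendsto (fun n => Qf V (un n)) atTop (𝓝 0)

/-- A ground state of `Q_V`: a positive C¹ function that is the limit of a null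
sequence in `L²(K)` for every compact `K`. -/
def GroundState {d : ℕ} (V : Ed d → ℝ) (φ : Ed d → ℝ) : Prop :=
  ContDiff ℝ 1 φ ∧ (∀ x, 0 < φ x) ∧
  ∃ un, NullSeq V un ∧ ∀ K : Set (Ed d), IsCompact K →
    Tendsto (fun n => ∫ x in K, (un n x - φ x) ^ 2) atTop (𝓝 0)

/-- `Q_V` is critical in ℝ^d. -/
def Crit {d : ℕ} (V : Ed d → ℝ) : Prop :=
  (∀ u, IsTest u → 0 ≤ Qf V u) ∧ ∃ φ, GroundState V φ

/-- The ground-state energy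
`E = sup{λ : ∫(|∇u|² + V u²) ≥ λ ∫ u² for all test functions u}`. -/
def Energy {d : ℕ} (V : Ed d → ℝ) : ℝ :=
  sSup {l : ℝ | ∀ u, IsTest u → l * ∫ x, u x ^ 2 ≤ Qf V u}

section Aux
variable {d : ℕ}

lemma norm_grad (f : Ed d → ℝ) (x : Ed d) : ‖gradient f x‖ = ‖fderiv ℝ f x‖ := by
  rw [← toDual_gradient]; exact (LinearIsometryEquiv.norm_map _ _).symm

lemma cont_grad {f : Ed d → ℝ} (hf : ContDiff ℝ 1 f) : Continuous (gradient f) := by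
  unfold gradient
  exact (LinearIsometryEquiv.continuous _).comp (hf.continuous_fderiv one_ne_zero)

lemma grad_zero_of {f : Ed d → ℝ} {K : Set (Ed d)} (hK : IsClosed K) (h : ∀ x ∉ K, f x = 0)
    {x : Ed d} (hx : x ∉ K) : gradient f x = 0 := by
  have : f =ᶠ[𝓝 x] fun _ => 0 := by
    filter_upwards [hK.isOpen_compl.mem_nhds hx] with y hy using h y hy
  unfold gradient
  rw [this.fderiv_eq]; simp

lemma grad_hcs {f : Ed d → ℝ} (hf : HasCompactSupport f) : HasCompactSupport (gradient f) := by
  refine HasCompactSupport.intro hf (fun x hx => ?_)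
  exact grad_zero_of (isClosed_tsupport f) (fun y hy => image_eq_zero_of_notMem_tsupport hy) hx

lemma inner_grad_sum (f g : Ed d → ℝ) (x : Ed d) : inner ℝ (gradient f x) (gradient g x)
    = ∑ i : Fin d, fderiv ℝ f x (EuclideanSpace.single i 1) * fderiv ℝ g x (EuclideanSpace.single i 1) := by
  rw [← (EuclideanSpace.basisFun (Fin d) ℝ).sum_inner_mul_inner]
  refine Finset.sum_congr rfl fun i _ => ?_
  rw [inner_gradient_left, inner_gradient_right]; simp

lemma hasGrad {f : Ed d → ℝ} (hf : ContDiff ℝ 1 f) (x : Ed d) :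
    HasGradientAt f (gradient f x) x :=
  ((hf.differentiable one_ne_zero) x).hasGradientAt

lemma grad_mul {f g : Ed d → ℝ} (hf : ContDiff ℝ 1 f) (hg : ContDiff ℝ 1 g) (x : Ed d) :
    gradient (fun y => f y * g y) x = f x • gradient g x + g x • gradient f x := by
  unfold gradient
  have := (((hf.differentiable one_ne_zero) x).hasFDerivAt.mul
    ((hg.differentiable one_ne_zero) x).hasFDerivAt).fderiv
  erw [this]; simp

lemma grad_add {f g : Ed d → ℝ} (hf : ContDiff ℝ 1 f) (hg : ContDiff ℝ 1 g) (x : Ed d) :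
    gradient (fun y => f y + g y) x = gradient f x + gradient g x := by
  unfold gradient
  have := (((hf.differentiable one_ne_zero) x).hasFDerivAt.add
    ((hg.differentiable one_ne_zero) x).hasFDerivAt).fderiv
  erw [this]; simp

lemma grad_cmul {f : Ed d → ℝ} (c : ℝ) (hf : ContDiff ℝ 1 f) (x : Ed d) :
    gradient (fun y => c * f y) x = c • gradient f x := by
  unfold gradient
  have := (((hf.differentiable one_ne_zero) x).hasFDerivAt.const_mul c).fderiv
  erw [this]; simp

lemma grad_comp {f : Ed d → ℝ} {g : ℝ → ℝ} {g' : ℝ} (hf : ContDiff ℝ 1 f) (x : Ed d)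
    (hg : HasDerivAt g g' (f x)) :
    gradient (fun y => g (f y)) x = g' • gradient f x := by
  unfold gradient
  have := (hg.comp_hasFDerivAt x ((hf.differentiable one_ne_zero) x).hasFDerivAt).fderiv
  erw [this]; simp

lemma grad_shift (f : Ed d → ℝ) (a x : Ed d) :
    gradient (fun y => f (y - a)) x = gradient f (x - a) := by
  unfold gradient
  rw [fderiv_comp_sub]

def lap (f : Ed d → ℝ) (x : Ed d) : ℝ :=
  ∑ i : Fin d, fderiv ℝ (fun y => fderiv ℝ f y (EuclideanSpace.single i 1)) x
    (EuclideanSpace.single i 1)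

lemma green {f v : Ed d → ℝ} (hf : ContDiff ℝ 2 f) (hv : ContDiff ℝ 1 v)
    (hc : HasCompactSupport f ∨ HasCompactSupport v) :
    ∫ x, inner ℝ (gradient f x) (gradient v x) = ∫ x, -lap f x * v x := by
  have hf1 : ∀ i : Fin d, ContDiff ℝ 1 (fun y => fderiv ℝ f y (EuclideanSpace.single i 1)) := fun i =>
    (hf.fderiv_right (m := 1) (by norm_num)).clm_apply contDiff_const
  have hc2 : ∀ e e' : Ed d, HasCompactSupport (fun x => fderiv ℝ f x e * fderiv ℝ v x e') ∧
     HasCompactSupport (fun x => fderiv ℝ f x e * v x) ∧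
     HasCompactSupport (fun x => fderiv ℝ (fun y => fderiv ℝ f y e) x e' * v x) := by
    intro e e'
    rcases hc with h | h
    · have h1 : HasCompactSupport (fun x => fderiv ℝ f x e) := h.fderiv_apply (𝕜 := ℝ) e
      have h2 : HasCompactSupport (fun x => fderiv ℝ (fun y => fderiv ℝ f y e) x e') :=
        h1.fderiv_apply (𝕜 := ℝ) e'
      exact ⟨h1.mul_right, h1.mul_right, h2.mul_right⟩
    · have h1 : HasCompactSupport (fun x => fderiv ℝ v x e') := h.fderiv_apply (𝕜 := ℝ) e'
      exact ⟨h1.mul_left, h.mul_left, h.mul_left⟩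
  have cv : ∀ e : Ed d, Continuous (fun x => fderiv ℝ v x e) := fun e =>
    (hv.continuous_fderiv one_ne_zero).clm_apply continuous_const
  have cf : ∀ i : Fin d, Continuous (fun x => fderiv ℝ f x (EuclideanSpace.single i 1)) :=
    fun i => (hf1 i).continuous
  have cff : ∀ i : Fin d, Continuous (fun x => fderiv ℝ (fun y => fderiv ℝ f y (EuclideanSpace.single i 1)) x (EuclideanSpace.single i 1)) :=
    fun i => ((hf1 i).continuous_fderiv one_ne_zero).clm_apply continuous_const
  have i1 : ∀ i : Fin d, Integrable (fun x => fderiv ℝ f x (EuclideanSpace.single i 1) * fderiv ℝ v x (EuclideanSpace.single i 1)) :=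
    fun i => ((cf i).mul (cv _)).integrable_of_hasCompactSupport (hc2 _ _).1
  have i2 : ∀ i : Fin d, Integrable (fun x => fderiv ℝ f x (EuclideanSpace.single i 1) * v x) :=
    fun i => ((cf i).mul hv.continuous).integrable_of_hasCompactSupport (hc2 _ (EuclideanSpace.single i 1)).2.1
  have i3 : ∀ i : Fin d, Integrable (fun x => fderiv ℝ (fun y => fderiv ℝ f y (EuclideanSpace.single i 1)) x (EuclideanSpace.single i 1) * v x) :=
    fun i => ((cff i).mul hv.continuous).integrable_of_hasCompactSupport (hc2 _ _).2.2
  simp_rw [inner_grad_sum, lap, neg_mul, Finset.sum_mul]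
  rw [integral_neg, integral_finsetSum _ (fun i _ => i1 i), integral_finsetSum _ (fun i _ => i3 i),
    ← Finset.sum_neg_distrib]
  refine Finset.sum_congr rfl fun i _ => ?_
  exact integral_mul_fderiv_eq_neg_fderiv_mul_of_integrable (i3 i) (i1 i) (i2 i)
    (fun x _ => ((hf1 i).differentiable one_ne_zero) x) (fun x _ => (hv.differentiable one_ne_zero) x)

/-- weak form of `-Δφ = F` -/
def WE (φ F : Ed d → ℝ) : Prop :=
  ∀ v : Ed d → ℝ, ContDiff ℝ 1 v → HasCompactSupport v →
    ∫ x, inner ℝ (gradient φ x) (gradient v x) = ∫ x, F x * v x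

lemma int_of {f : Ed d → ℝ} (hc : Continuous f) (hs : HasCompactSupport f) : Integrable f :=
  hc.integrable_of_hasCompactSupport hs

lemma int_mul {F v : Ed d → ℝ} (hF : Continuous F) (hv : Continuous v) (hs : HasCompactSupport v) :
    Integrable (fun x => F x * v x) := int_of (hF.mul hv) hs.mul_left

lemma inner_int {f v : Ed d → ℝ} (hf : ContDiff ℝ 1 f) (hv : ContDiff ℝ 1 v)
    (hc : HasCompactSupport v) : Integrable (fun x => inner ℝ (gradient f x) (gradient v x)) := by
  refine int_of ((cont_grad hf).inner (cont_grad hv)) ?_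
  refine HasCompactSupport.intro (grad_hcs hc) (fun x hx => ?_)
  rw [image_eq_zero_of_notMem_tsupport hx]; simp

lemma WE.add {φ F ψ H : Ed d → ℝ} (hφ : ContDiff ℝ 1 φ) (hψ : ContDiff ℝ 1 ψ)
    (hF : Continuous F) (hH : Continuous H) (h1 : WE φ F) (h2 : WE ψ H) :
    WE (fun x => φ x + ψ x) (fun x => F x + H x) := by
  intro v hv hc
  simp_rw [grad_add hφ hψ, inner_add_left, add_mul]
  rw [integral_add (inner_int hφ hv hc) (inner_int hψ hv hc), h1 v hv hc, h2 v hv hc,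
    integral_add (int_mul hF hv.continuous hc) (int_mul hH hv.continuous hc)]

lemma WE.cmul {φ F : Ed d → ℝ} (c : ℝ) (hφ : ContDiff ℝ 1 φ) (h1 : WE φ F) :
    WE (fun x => c * φ x) (fun x => c * F x) := by
  intro v hv hc
  simp_rw [grad_cmul c hφ, real_inner_smul_left, mul_assoc]
  rw [integral_const_mul, integral_const_mul, h1 v hv hc]

lemma WE.shift {φ F : Ed d → ℝ} (a : Ed d) (h1 : WE φ F) :
    WE (fun x => φ (x - a)) (fun x => F (x - a)) := by
  intro v hv hc
  have := h1 (fun x => v (x + a)) (by fun_prop)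
    (hc.comp_homeomorph (Homeomorph.addRight a))
  rw [← integral_sub_right_eq_self _ a, ← integral_sub_right_eq_self (fun x => F x * _) a] at this
  simp_rw [grad_shift φ a]
  have e : ∀ x, gradient (fun x => v (x + a)) (x - a) = gradient v x := by
    intro x
    have := grad_shift v (-a) (x - a)
    simpa only [sub_neg_eq_add, sub_add_cancel] using this
  simp_rw [e, sub_add_cancel] at this
  exact this

/-- ground state identity -/
lemma gs_ident {W P ψ : Ed d → ℝ} (hW : ContDiff ℝ 1 W) (hWE : WE W P)
    (hψ : ContDiff ℝ 1 ψ) (hc : HasCompactSupport ψ) :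
    ∫ x, ‖gradient (fun y => W y * ψ y) x‖ ^ 2
      = (∫ x, W x ^ 2 * ‖gradient ψ x‖ ^ 2) + ∫ x, P x * (W x * ψ x ^ 2) := by
  have hv : ContDiff ℝ 1 (fun y => W y * ψ y ^ 2) := by fun_prop
  have hvc : HasCompactSupport (fun y => W y * ψ y ^ 2) := by
    have : HasCompactSupport (fun y => W y * ψ y * ψ y) := hc.mul_left
    convert this using 2; ring
  rw [← hWE _ hv hvc, ← integral_add _ (inner_int hW hv hvc)]
  · congr 1; ext x
    have e2 : gradient (fun y => W y * ψ y ^ 2) x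
        = ψ x ^ 2 • gradient W x + (2 * W x * ψ x) • gradient ψ x := by
      have e1 : (fun y => W y * ψ y ^ 2) = fun y => W y * (ψ y * ψ y) := by ext; ring
      rw [e1, grad_mul hW (hψ.mul hψ), grad_mul hψ hψ]; module
    rw [e2, grad_mul hW hψ, ← real_inner_self_eq_norm_sq, ← real_inner_self_eq_norm_sq]
    simp only [inner_add_left, inner_add_right, real_inner_smul_left, real_inner_smul_right]
    rw [real_inner_comm (gradient ψ x) (gradient W x)]
    ring
  · refine int_of (by have := cont_grad hψ; have := hW.continuous; fun_prop) ?_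
    refine HasCompactSupport.intro (grad_hcs hc) (fun x hx => ?_)
    rw [image_eq_zero_of_notMem_tsupport hx]; simp

lemma density {v : Ed d → ℝ} (hv : ContDiff ℝ 1 v) (hc : HasCompactSupport v) :
    ∃ vn : ℕ → Ed d → ℝ, ∃ K : Set (Ed d), ∃ M : ℝ, (∀ n, IsTest (vn n)) ∧ IsCompact K ∧
      (∀ n x, x ∉ K → vn n x = 0) ∧ (∀ n x, x ∉ K → gradient (vn n) x = 0) ∧
      (∀ n x, |vn n x| ≤ M) ∧ (∀ n x, ‖gradient (vn n) x‖ ≤ M) ∧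
      (∀ x, Tendsto (fun n => vn n x) atTop (𝓝 (v x))) ∧
      (∀ x, Tendsto (fun n => gradient (vn n) x) atTop (𝓝 (gradient v x))) := by
  let φ : ℕ → ContDiffBump (0 : Ed d) := fun n =>
    ⟨1 / (2 * ((n : ℝ) + 1)), 1 / ((n : ℝ) + 1), by positivity, by
      apply one_div_lt_one_div_of_lt <;> [positivity; linarith [(Nat.cast_nonneg n : (0:ℝ) ≤ n)]]⟩
  have hφ : Tendsto (fun n => (φ n).rOut) atTop (𝓝 0) := tendsto_one_div_add_atTop_nhds_zero_nat
  have hφ1 : ∀ n, (φ n).rOut ≤ 1 := fun n => by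
    show 1 / ((n : ℝ) + 1) ≤ 1
    rw [div_le_one (by positivity)]; linarith [(Nat.cast_nonneg n : (0:ℝ) ≤ n)]
  obtain ⟨M1, hM1⟩ := hv.continuous.bounded_above_of_compact_support hc
  obtain ⟨M2, hM2⟩ := (hv.continuous_fderiv one_ne_zero).bounded_above_of_compact_support
    (hc.fderiv (𝕜 := ℝ))
  let vn : ℕ → Ed d → ℝ := fun n =>
    convolution ((φ n).normed volume) v (ContinuousLinearMap.lsmul ℝ ℝ) volume
  let K := Metric.cthickening 1 (tsupport v)
  have hKc : IsCompact K := IsCompact.cthickening hc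
  have hl : ∀ n, LocallyIntegrable ((φ n).normed volume) volume := fun n =>
    ((φ n).continuous_normed).locallyIntegrable
  have hfd : ∀ n x, fderiv ℝ (vn n) x =
      (convolution ((φ n).normed volume) (fderiv ℝ v) (ContinuousLinearMap.lsmul ℝ ℝ) volume) x := by
    intro n x
    exact (hc.hasFDerivAt_convolution_right (ContinuousLinearMap.lsmul ℝ ℝ) (hl n) hv x).fderiv
  have hvK : ∀ n x, x ∉ K → vn n x = 0 := by
    intro n x hx
    have h0 : ∀ y ∈ Metric.ball x (φ n).rOut, v y = v x := by
      intro y hy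
      have h1 : ∀ y ∈ Metric.ball x (φ n).rOut, v y = 0 := by
        intro y hy
        by_contra h
        apply hx
        refine Metric.mem_cthickening_of_dist_le x y 1 _ (subset_tsupport v h) ?_
        rw [dist_comm]
        exact (Metric.mem_ball.1 hy).le.trans (hφ1 n)
      rw [h1 y hy, h1 x (Metric.mem_ball_self (φ n).rOut_pos)]
    rw [show vn n x = v x from (φ n).normed_convolution_eq_right h0]
    by_contra h
    exact hx (Metric.self_subset_cthickening _ (subset_tsupport v h))
  have htest : ∀ n, IsTest (vn n) := by
    intro n
    refine ⟨?_, HasCompactSupport.intro hKc (hvK n)⟩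
    exact HasCompactSupport.contDiff_convolution_left _ (φ n).hasCompactSupport_normed
      (φ n).contDiff_normed hv.continuous.locallyIntegrable
  refine ⟨vn, K, max M1 M2, htest, hKc, hvK, ?_, ?_, ?_, ?_, ?_⟩
  · intro n x hx
    exact grad_zero_of hKc.isClosed (hvK n) hx
  · intro n x
    have := dist_convolution_le (μ := volume) (x₀ := x) (z₀ := (0:ℝ)) (g := v)
      (f := (φ n).normed volume) (R := (φ n).rOut) (ε := M1) ((norm_nonneg _).trans (hM1 0))
      ((φ n).support_normed_eq.subset) (fun x => (φ n).nonneg_normed x) ((φ n).integral_normed)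
      hv.continuous.aestronglyMeasurable (fun y _ => by simpa using hM1 y)
    rw [dist_zero_right] at this
    exact this.trans (le_max_left _ _)
  · intro n x
    rw [norm_grad, hfd]
    have := dist_convolution_le (μ := volume) (x₀ := x) (z₀ := (0 : Ed d →L[ℝ] ℝ)) (g := fderiv ℝ v)
      (f := (φ n).normed volume) (R := (φ n).rOut) (ε := M2) ((norm_nonneg _).trans (hM2 0))
      ((φ n).support_normed_eq.subset) (fun x => (φ n).nonneg_normed x) ((φ n).integral_normed)
      (hv.continuous_fderiv one_ne_zero).aestronglyMeasurable (fun y _ => by simpa using hM2 y)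
    rw [dist_zero_right] at this
    exact this.trans (le_max_right _ _)
  · intro x
    exact ContDiffBump.convolution_tendsto_right_of_continuous hφ hv.continuous x
  · intro x
    unfold gradient
    refine ((LinearIsometryEquiv.continuous _).tendsto _).comp ?_
    simp_rw [hfd]
    exact ContDiffBump.convolution_tendsto_right_of_continuous hφ (hv.continuous_fderiv one_ne_zero) x

/-- dominated convergence with compact support -/
lemma dct_compact {F : ℕ → Ed d → ℝ} {f : Ed d → ℝ} {K : Set (Ed d)} (hK : IsCompact K) (g : Ed d → ℝ)
    (hg : Continuous g) (hF : ∀ n, Continuous (F n)) (h0 : ∀ n x, x ∉ K → F n x = 0)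
    (hb : ∀ n x, |F n x| ≤ g x) (hl : ∀ x, Tendsto (fun n => F n x) atTop (𝓝 (f x))) :
    Tendsto (fun n => ∫ x, F n x) atTop (𝓝 (∫ x, f x)) := by
  refine tendsto_integral_of_dominated_convergence (K.indicator g)
    (fun n => (hF n).aestronglyMeasurable) ?_ ?_ (Eventually.of_forall hl)
  · exact (integrable_indicator_iff hK.measurableSet).2 (hg.continuousOn.integrableOn_compact hK)
  · intro n
    refine Eventually.of_forall fun x => ?_
    by_cases hx : x ∈ K
    · rw [Set.indicator_of_mem hx]; exact hb n x
    · rw [Set.indicator_of_notMem hx, h0 n x hx]; simp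

lemma WE_of_test {φ F : Ed d → ℝ} (hφ : ContDiff ℝ 1 φ) (hF : Continuous F)
    (h : ∀ v, IsTest v → ∫ x, inner ℝ (gradient φ x) (gradient v x) = ∫ x, F x * v x) : WE φ F := by
  intro v hv hc
  obtain ⟨vn, K, M, ht, hK, h0, h0', hM, hM', hl, hl'⟩ := density hv hc
  have hc1 : ∀ n, ContDiff ℝ 1 (vn n) := fun n => (ht n).1.of_le (by exact_mod_cast le_top)
  have t1 : Tendsto (fun n => ∫ x, inner ℝ (gradient φ x) (gradient (vn n) x)) atTop
      (𝓝 (∫ x, inner ℝ (gradient φ x) (gradient v x))) := by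
    refine dct_compact hK (fun x => ‖gradient φ x‖ * M) ((cont_grad hφ).norm.mul continuous_const)
      (fun n => (cont_grad hφ).inner (cont_grad (hc1 n))) (fun n x hx => by rw [h0' n x hx]; simp)
      (fun n x => ?_) (fun x => tendsto_const_nhds.inner (hl' x))
    exact (abs_real_inner_le_norm _ _).trans (by gcongr; exact hM' n x)
  have t2 : Tendsto (fun n => ∫ x, F x * (vn n x)) atTop (𝓝 (∫ x, F x * v x)) := by
    refine dct_compact hK (fun x => |F x| * M) (hF.abs.mul continuous_const)
      (fun n => hF.mul (hc1 n).continuous) (fun n x hx => by rw [h0 n x hx]; simp)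
      (fun n x => ?_) (fun x => tendsto_const_nhds.mul (hl x))
    rw [abs_mul]; gcongr; exact hM n x
  refine tendsto_nhds_unique t1 (t2.congr fun n => (h _ (ht n)).symm)

lemma IsTest.c1 {v : Ed d → ℝ} (h : IsTest v) : ContDiff ℝ 1 v := h.1.of_le (by exact_mod_cast le_top)

lemma Q_int {V u : Ed d → ℝ} (hV : Continuous V) (hu : ContDiff ℝ 1 u) (hc : HasCompactSupport u) :
    Integrable (fun x => ‖gradient u x‖ ^ 2) ∧ Integrable (fun x => V x * u x ^ 2) := by
  constructor
  · refine int_of ((cont_grad hu).norm.pow 2) ?_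
    exact (grad_hcs hc).comp_left (g := fun z => ‖z‖ ^ 2) (by simp)
  · refine int_of (hV.mul (hu.continuous.pow 2)) ?_
    exact (hc.comp_left (g := fun z => z ^ 2) (by simp)).mul_left

lemma Q_split {V u : Ed d → ℝ} (hV : Continuous V) (hu : ContDiff ℝ 1 u) (hc : HasCompactSupport u) :
    Qf V u = (∫ x, ‖gradient u x‖ ^ 2) + ∫ x, V x * u x ^ 2 :=
  integral_add (Q_int hV hu hc).1 (Q_int hV hu hc).2

/-- extension of energy bounds to C¹ compactly supported functions -/
lemma energy_C1 {V : Ed d → ℝ} {l : ℝ} (hV : Continuous V)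
    (h : ∀ u, IsTest u → l * ∫ x, u x ^ 2 ≤ Qf V u) {v : Ed d → ℝ}
    (hv : ContDiff ℝ 1 v) (hc : HasCompactSupport v) : l * ∫ x, v x ^ 2 ≤ Qf V v := by
  obtain ⟨vn, K, M, ht, hK, h0, h0', hM, hM', hl, hl'⟩ := density hv hc
  have t1 : Tendsto (fun n => Qf V (vn n)) atTop (𝓝 (Qf V v)) := by
    refine dct_compact hK (fun x => M ^ 2 + |V x| * M ^ 2) (by fun_prop)
      (fun n => ?_) (fun n x hx => by rw [h0' n x hx, h0 n x hx]; simp)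
      (fun n x => ?_) (fun x => ((hl' x).norm.pow 2).add (tendsto_const_nhds.mul ((hl x).pow 2)))
    · have := cont_grad (ht n).c1; have := (ht n).c1.continuous; fun_prop
    · refine (abs_add_le _ _).trans ?_
      rw [abs_mul, abs_of_nonneg (sq_nonneg _), abs_of_nonneg (sq_nonneg (vn n x)), ← sq_abs (vn n x)]
      gcongr
      · exact hM' n x
      · exact hM n x
  have t2 : Tendsto (fun n => ∫ x, (vn n x) ^ 2) atTop (𝓝 (∫ x, v x ^ 2)) := by
    refine dct_compact hK (fun x => M ^ 2) (by fun_prop)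
      (fun n => (ht n).c1.continuous.pow 2) (fun n x hx => by rw [h0 n x hx]; simp)
      (fun n x => ?_) (fun x => ((hl x).pow 2))
    rw [abs_of_nonneg (sq_nonneg (vn n x)), ← sq_abs (vn n x)]
    gcongr
    exact hM n x
  exact le_of_tendsto_of_tendsto' (t2.const_mul l) t1 (fun n => h _ (ht n))

lemma radial_hasFDeriv {g : ℝ → ℝ} {g' : ℝ} (a x : Ed d) (h : HasDerivAt g g' (‖x - a‖ ^ 2)) :
    HasFDerivAt (fun y => g (‖y - a‖ ^ 2)) ((2 * g') • innerSL ℝ (x - a)) x := by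
  have h1 : HasFDerivAt (fun y : Ed d => ‖y - a‖ ^ 2) ((2 : ℝ) • innerSL ℝ (x - a)) x := by
    have := ((hasFDerivAt_id x).sub_const a).norm_sq
    refine HasFDerivAt.congr_fderiv this ?_
    ext z; simp
  have := h.comp_hasFDerivAt x h1
  refine HasFDerivAt.congr_fderiv this ?_
  rw [smul_smul, mul_comm]

lemma radial_grad {g : ℝ → ℝ} {g' : ℝ} (a x : Ed d) (h : HasDerivAt g g' (‖x - a‖ ^ 2)) :
    gradient (fun y => g (‖y - a‖ ^ 2)) x = (2 * g') • (x - a) := by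
  refine HasGradientAt.gradient ?_
  rw [hasGradientAt_iff_hasFDerivAt]
  refine HasFDerivAt.congr_fderiv (radial_hasFDeriv a x h) ?_
  ext z; simp

lemma radial_lap {g g1 g2 : ℝ → ℝ} (a x : Ed d) (h1 : ∀ t, 0 ≤ t → HasDerivAt g (g1 t) t)
    (h2 : ∀ t, 0 ≤ t → HasDerivAt g1 (g2 t) t) :
    lap (fun y => g (‖y - a‖ ^ 2)) x
      = 4 * g2 (‖x - a‖ ^ 2) * ‖x - a‖ ^ 2 + 2 * d * g1 (‖x - a‖ ^ 2) := by
  unfold lap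
  have e1 : ∀ i : Fin d, (fun y => fderiv ℝ (fun y => g (‖y - a‖ ^ 2)) y (EuclideanSpace.single i 1))
      = fun y => g1 (‖y - a‖ ^ 2) * (2 * (y i - a i)) := by
    intro i; ext y
    rw [(radial_hasFDeriv a y (h1 _ (by positivity))).fderiv]
    simp [EuclideanSpace.inner_single_right]
    ring
  have e2 : ∀ i : Fin d, fderiv ℝ (fun y => fderiv ℝ (fun y => g (‖y - a‖ ^ 2)) y (EuclideanSpace.single i 1)) x (EuclideanSpace.single i 1) = 4 * g2 (‖x - a‖ ^ 2) * (x i - a i) ^ 2 + 2 * g1 (‖x - a‖ ^ 2) := by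
    intro i
    rw [e1]
    have k1 := radial_hasFDeriv a x (h2 _ (by positivity : 0 ≤ ‖x - a‖ ^ 2))
    have k2 : HasFDerivAt (fun y : Ed d => 2 * (y i - a i)) ((2 : ℝ) • (EuclideanSpace.proj i : Ed d →L[ℝ] ℝ)) x := by
      have : HasFDerivAt (fun y : Ed d => y i) (EuclideanSpace.proj i : Ed d →L[ℝ] ℝ) x :=
        (EuclideanSpace.proj i : Ed d →L[ℝ] ℝ).hasFDerivAt
      exact (this.sub_const (a i)).const_mul 2
    erw [(k1.mul k2).fderiv]
    simp [EuclideanSpace.inner_single_right]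
    ring
  simp_rw [e2]
  rw [Finset.sum_add_distrib, ← Finset.mul_sum, EuclideanSpace.norm_sq_eq]
  simp
  ring

def w (b : ℝ) (x : Ed d) : ℝ := (1 + ‖x‖ ^ 2) ^ (-b / 2)

lemma w_pos (b : ℝ) (x : Ed d) : 0 < w b x := by unfold w; positivity

lemma w_mul (a b : ℝ) (x : Ed d) : w a x * w b x = w (a + b) x := by
  unfold w
  rw [← Real.rpow_add (by positivity)]; congr 1; ring

lemma w_mul' {a b c : ℝ} (h : a + b = c) (x : Ed d) : w a x * w b x = w c x := by
  rw [w_mul, h]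

lemma w_anti {a b : ℝ} (h : a ≤ b) (x : Ed d) : w b x ≤ w a x := by
  unfold w
  refine Real.rpow_le_rpow_of_exponent_le (by nlinarith [sq_nonneg ‖x‖]) (by linarith)

lemma w_zero (x : Ed d) : w 0 x = 1 := by simp [w]

lemma w_le_one {b : ℝ} (h : 0 ≤ b) (x : Ed d) : w b x ≤ 1 := by
  rw [← w_zero x]; exact w_anti h x

lemma w_contDiff (b : ℝ) {n : WithTop ℕ∞} : ContDiff ℝ n (w b : Ed d → ℝ) := by
  unfold w
  refine ContDiff.rpow_const_of_ne (by have := contDiff_norm_sq ℝ (E := Ed d) (n := n); fun_prop) (fun x => by positivity)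

lemma w_cont (b : ℝ) : Continuous (w b : Ed d → ℝ) := (w_contDiff b (n := 1)).continuous

lemma w_int {b : ℝ} (h : (d : ℝ) < b) : Integrable (w b : Ed d → ℝ) := by
  unfold w
  exact integrable_rpow_neg_one_add_norm_sq (by simpa using h)

lemma w_tendsto {b : ℝ} (hb : 0 < b) : Tendsto (w b : Ed d → ℝ) (Bornology.cobounded (Ed d)) (𝓝 0) := by
  unfold w
  have h1 : Tendsto (fun x : Ed d => 1 + ‖x‖ ^ 2) (Bornology.cobounded (Ed d)) atTop :=
    tendsto_atTop_add_const_left _ _ ((tendsto_pow_atTop two_ne_zero).comp tendsto_norm_cobounded_atTop)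
  have := (tendsto_rpow_neg_atTop (y := b / 2) (by positivity)).comp h1
  refine this.congr fun x => ?_
  simp only [Function.comp]; congr 1; ring

lemma rpow_deriv (c p t : ℝ) (h : 0 < c + t) :
    HasDerivAt (fun t => (c + t) ^ p) (p * (c + t) ^ (p - 1)) t := by
  have := (((hasDerivAt_id t).const_add c)).rpow_const (p := p) (Or.inl h.ne')
  simpa using this

def Pw (b : ℝ) (x : Ed d) : ℝ := b * (d - 2 - b) * w (b + 2) x + b * (b + 2) * w (b + 4) x

lemma lap_w (b : ℝ) (x : Ed d) : -lap (w b) x = Pw b x := by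
  have := radial_lap (g := fun t => (1 + t) ^ (-b / 2)) (g1 := fun t => -b / 2 * (1 + t) ^ (-b / 2 - 1))
    (g2 := fun t => -b / 2 * ((-b / 2 - 1) * (1 + t) ^ (-b / 2 - 1 - 1))) 0 x
    (fun t ht => rpow_deriv _ _ _ (by positivity))
    (fun t ht => (rpow_deriv _ _ _ (by positivity)).const_mul _)
  simp only [sub_zero] at this
  unfold w Pw
  rw [this]
  unfold w
  have hs : 0 < 1 + ‖x‖ ^ 2 := by positivity
  have e1 : (1 + ‖x‖ ^ 2) ^ (-(b + 2) / 2) = (1 + ‖x‖ ^ 2) ^ (-(b + 4) / 2) * (1 + ‖x‖ ^ 2) := by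
    nth_rewrite 3 [← Real.rpow_one (1 + ‖x‖ ^ 2)]
    rw [← Real.rpow_add hs]; congr 1; ring
  have e2 : -b / 2 - 1 = -(b + 2) / 2 := by ring
  have e3 : -(b + 2) / 2 - 1 = -(b + 4) / 2 := by ring
  rw [e2, e3, e1]
  ring

lemma Pw_cont (b : ℝ) : Continuous (Pw b : Ed d → ℝ) := by
  unfold Pw
  have := w_cont (d := d) (b + 2); have := w_cont (d := d) (b + 4); fun_prop

lemma WE_w (b : ℝ) : WE (w b : Ed d → ℝ) (Pw b) := by
  intro v hv hc
  rw [green (w_contDiff b) hv (Or.inr hc)]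
  simp_rw [lap_w]

lemma Pw_ge {b : ℝ} (h0 : 0 < b) (x : Ed d) :
    b * (d - 2 - b) * w (b + 2) x ≤ Pw b x := by
  unfold Pw
  have := w_pos (b + 4) x
  have : 0 ≤ b * (b + 2) * w (b + 4) x := by positivity
  linarith

lemma hardy (hd : 5 ≤ d) {u : Ed d → ℝ} (hu : ContDiff ℝ 1 u) (hc : HasCompactSupport u) :
    ∫ x, w 2 x * u x ^ 2 ≤ ∫ x, ‖gradient u x‖ ^ 2 := by
  have hd' : (5 : ℝ) ≤ d := by exact_mod_cast hd
  have hψ : ContDiff ℝ 1 (fun x => w (-1) x * u x) := (w_contDiff _).mul hu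
  have hψc : HasCompactSupport (fun x => w (-1) x * u x) := hc.mul_left
  have e : (fun y => w 1 y * (w (-1) y * u y)) = u := by
    ext y; rw [← mul_assoc, w_mul' (c := 0) (by norm_num), w_zero, one_mul]
  have := gs_ident (w_contDiff 1) (WE_w 1) hψ hψc
  rw [e] at this
  rw [this]
  have h0 : 0 ≤ ∫ x, w 1 x ^ 2 * ‖gradient (fun x => w (-1) x * u x) x‖ ^ 2 :=
    integral_nonneg fun x => by positivity
  refine le_add_of_nonneg_of_le h0 ?_
  refine integral_mono (Q_int (w_cont 2) hu hc).2 ?_ fun x => ?_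
  · refine int_mul (Pw_cont 1) ?_ ?_
    · have := w_cont (d := d) 1; have := hψ.continuous; fun_prop
    · exact (hψc.comp_left (g := fun z => z ^ 2) (by simp)).mul_left
  · have h1 := Pw_ge (d := d) (b := 1) one_pos x
    have h2 : w 1 x * (w (-1) x * u x) ^ 2 = w (-1) x * u x ^ 2 := by
      have : w 1 x * w (-1) x = 1 := by rw [w_mul' (c := 0) (by norm_num), w_zero]
      linear_combination (w (-1) x * u x ^ 2) * this
    simp only
    rw [h2]
    have h3 : w 2 x * u x ^ 2 = w (1 + 2) x * (w (-1) x * u x ^ 2) := by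
      rw [← mul_assoc, w_mul' (c := 2) (by norm_num)]
    rw [h3]
    have := w_pos (-1) x
    have := w_pos (1 + 2) x
    refine mul_le_mul_of_nonneg_right ?_ (by positivity)
    nlinarith

def eta (s : ℝ) : ℝ := Real.smoothTransition (2 - s)
def eta1 (s : ℝ) : ℝ := deriv eta s
def eta2 (s : ℝ) : ℝ := deriv eta1 s

lemma eta_cd {n : ℕ∞} : ContDiff ℝ n eta := by
  unfold eta
  exact Real.smoothTransition.contDiff.comp (contDiff_const.sub contDiff_id)

lemma eta1_cd : ContDiff ℝ 1 eta1 := by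
  have : ContDiff ℝ (1 + 1) eta := eta_cd (n := 2)
  exact (contDiff_succ_iff_deriv.1 this).2.2

lemma eta_deriv (s : ℝ) : HasDerivAt eta (eta1 s) s :=
  ((eta_cd (n := 1)).differentiable one_ne_zero s).hasDerivAt

lemma eta1_deriv (s : ℝ) : HasDerivAt eta1 (eta2 s) s :=
  (eta1_cd.differentiable one_ne_zero s).hasDerivAt

lemma eta_one {s : ℝ} (h : s ≤ 1) : eta s = 1 := Real.smoothTransition.one_of_one_le (by linarith)
lemma eta_zero {s : ℝ} (h : 2 ≤ s) : eta s = 0 := Real.smoothTransition.zero_of_nonpos (by linarith)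
lemma eta_nonneg (s : ℝ) : 0 ≤ eta s := Real.smoothTransition.nonneg _
lemma eta_le (s : ℝ) : eta s ≤ 1 := Real.smoothTransition.le_one _

lemma eta1_zero {s : ℝ} (h : s ∉ Set.Icc (1:ℝ) 2) : eta1 s = 0 := by
  unfold eta1
  by_cases h1 : s < 1
  · have : eta =ᶠ[𝓝 s] fun _ => 1 := by
      filter_upwards [Iio_mem_nhds h1] with y hy using eta_one (le_of_lt hy)
    rw [this.deriv_eq]; simp
  · have h2 : 2 < s := by
      by_contra h2; exact h ⟨not_lt.1 h1, not_lt.1 h2⟩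
    have : eta =ᶠ[𝓝 s] fun _ => 0 := by
      filter_upwards [Ioi_mem_nhds h2] with y hy using eta_zero (le_of_lt hy)
    rw [this.deriv_eq]; simp

lemma eta2_zero {s : ℝ} (h : s ∉ Set.Icc (1:ℝ) 2) : eta2 s = 0 := by
  unfold eta2
  have : eta1 =ᶠ[𝓝 s] fun _ => 0 := by
    filter_upwards [isClosed_Icc.isOpen_compl.mem_nhds h] with y hy using eta1_zero hy
  rw [this.deriv_eq]; simp

lemma eta_bd : ∃ B : ℝ, 0 ≤ B ∧ (∀ s, |eta1 s| ≤ B) ∧ ∀ s, |eta2 s| ≤ B := by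
  obtain ⟨B1, h1⟩ := eta1_cd.continuous.bounded_above_of_compact_support
    (HasCompactSupport.intro (isCompact_Icc (a := (1:ℝ)) (b := 2)) (fun s hs => eta1_zero hs))
  have c2 : Continuous eta2 := by
    have : ContDiff ℝ (0 + 1) eta1 := by simpa using eta1_cd
    exact (contDiff_succ_iff_deriv.1 this).2.2.continuous
  obtain ⟨B2, h2⟩ := c2.bounded_above_of_compact_support
    (HasCompactSupport.intro (isCompact_Icc (a := (1:ℝ)) (b := 2)) (fun s hs => eta2_zero hs))
  refine ⟨max B1 B2, ((norm_nonneg _).trans (h1 0)).trans (le_max_left _ _),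
    fun s => (h1 s).trans (le_max_left _ _), fun s => (h2 s).trans (le_max_right _ _)⟩

def pp (d : ℕ) : ℝ := (2 - d) / 2

def gg (d : ℕ) (c M t : ℝ) : ℝ := eta (t / M) * (c + t) ^ pp d
def gg1 (d : ℕ) (c M t : ℝ) : ℝ :=
  eta1 (t / M) / M * (c + t) ^ pp d + eta (t / M) * (pp d * (c + t) ^ (pp d - 1))
def gg2 (d : ℕ) (c M t : ℝ) : ℝ :=
  (eta2 (t / M) / M / M * (c + t) ^ pp d + eta1 (t / M) / M * (pp d * (c + t) ^ (pp d - 1))) +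
  (eta1 (t / M) / M * (pp d * (c + t) ^ (pp d - 1)) +
    eta (t / M) * (pp d * ((pp d - 1) * (c + t) ^ (pp d - 1 - 1))))

lemma eta_div_deriv (M t : ℝ) : HasDerivAt (fun t => eta (t / M)) (eta1 (t / M) / M) t := by
  have := (eta_deriv (t / M)).comp t ((hasDerivAt_id t).div_const M)
  simpa [div_eq_mul_inv, Function.comp_def] using this

lemma eta1_div_deriv (M t : ℝ) : HasDerivAt (fun t => eta1 (t / M) / M) (eta2 (t / M) / M / M) t := by
  have := ((eta1_deriv (t / M)).comp t ((hasDerivAt_id t).div_const M)).div_const M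
  simpa [div_eq_mul_inv, Function.comp_def] using this

lemma gg_deriv {c M t : ℝ} (h : 0 < c + t) : HasDerivAt (gg d c M) (gg1 d c M t) t :=
  (eta_div_deriv M t).mul (rpow_deriv c (pp d) t h)

lemma gg1_deriv {c M t : ℝ} (h : 0 < c + t) : HasDerivAt (gg1 d c M) (gg2 d c M t) t :=
  ((eta1_div_deriv M t).mul (rpow_deriv c (pp d) t h)).add
    ((eta_div_deriv M t).mul ((rpow_deriv c (pp d - 1) t h).const_mul (pp d)))

def rho (d : ℕ) (c t : ℝ) : ℝ := d * (d - 2) * c * (c + t) ^ (pp d - 2)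

def err (d : ℕ) (c M t : ℝ) : ℝ :=
  4 * t * (eta2 (t / M) / M / M * (c + t) ^ pp d + 2 * (eta1 (t / M) / M * (pp d * (c + t) ^ (pp d - 1))))
    + 2 * d * (eta1 (t / M) / M * (c + t) ^ pp d)

lemma gg_lap {c M t : ℝ} (h : 0 < c + t) :
    -(4 * gg2 d c M t * t + 2 * d * gg1 d c M t) = eta (t / M) * rho d c t - err d c M t := by
  unfold gg1 gg2 rho err
  have e1 : (c + t) ^ (pp d - 1) = (c + t) ^ (pp d - 2) * (c + t) := by
    nth_rewrite 3 [← Real.rpow_one (c + t)]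
    rw [← Real.rpow_add h]; congr 1; ring
  have e2 : pp d - 1 - 1 = pp d - 2 := by ring
  rw [e2, e1]
  have : (d : ℝ) = 2 - 2 * pp d := by unfold pp; ring
  rw [this]
  ring

lemma err_zero {c M t : ℝ} (hM : 1 ≤ M) (h : t < M) : err d c M t = 0 := by
  have : t / M ∉ Set.Icc (1:ℝ) 2 := fun h' => by
    have := h'.1; rw [le_div_iff₀ (by linarith)] at this; linarith
  unfold err
  rw [eta1_zero this, eta2_zero this]; simp

lemma pow_bd (hd : 5 ≤ d) {c t : ℝ} (hc : 0 < c) (ht : 1 ≤ t) :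
    (c + t) ^ (pp d - 1) ≤ 2 ^ ((d:ℝ) / 2) * (1 + t) ^ (-(d:ℝ) / 2) := by
  have h1 : (c + t) ^ (pp d - 1) ≤ ((1 + t) / 2) ^ (pp d - 1) := by
    refine Real.rpow_le_rpow_of_nonpos (by linarith) (by linarith) ?_
    unfold pp; have : (5:ℝ) ≤ d := by exact_mod_cast hd
    linarith
  refine h1.trans (le_of_eq ?_)
  rw [Real.div_rpow (by linarith) (by norm_num), show pp d - 1 = -(d:ℝ) / 2 by unfold pp; ring,
    div_eq_mul_inv, ← Real.rpow_neg (by norm_num), mul_comm]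
  congr 2; ring

lemma err_bd (hd : 5 ≤ d) : ∃ C : ℝ, 0 ≤ C ∧ ∀ c M t : ℝ, 0 < c → c ≤ 1 → 1 ≤ M → 0 ≤ t →
    |err d c M t| ≤ C * (1 + t) ^ (-(d:ℝ) / 2) := by
  obtain ⟨B, hB, h1, h2⟩ := eta_bd
  refine ⟨(4 * (2 * (B * 2 * 2) + 2 * (B * 2 * |pp d|)) + 2 * d * (B * 2 * 2)) * 2 ^ ((d:ℝ) / 2),
    by positivity, fun c M t hc hc1 hM ht => ?_⟩
  by_cases hs : t / M ∈ Set.Icc (1:ℝ) 2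
  swap
  · unfold err
    rw [eta1_zero hs, eta2_zero hs]; simp only [zero_div, zero_mul, mul_zero, add_zero, abs_zero]
    positivity
  have hM0 : 0 < M := by linarith
  have htM : M ≤ t := by have := hs.1; rw [le_div_iff₀ hM0] at this; linarith
  have ht1 : 1 ≤ t := hM.trans htM
  have hct : 0 < c + t := by linarith
  set X := (c + t) ^ (pp d - 1) with hX
  have hX0 : 0 < X := by positivity
  have e1 : (c + t) ^ pp d = X * (c + t) := by
    rw [hX]; nth_rewrite 3 [← Real.rpow_one (c + t)]
    rw [← Real.rpow_add hct]; congr 1; ring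
  set q := t / M with hq
  have hq0 : 0 ≤ q := by positivity
  have hq2 := hs.2
  have hr : (c + t) / t ≤ 2 := by rw [div_le_iff₀ (by linarith)]; linarith
  have hr0 : 0 ≤ (c + t) / t := by positivity
  set r := (c + t) / t with hrr
  have e2 : err d c M t = (4 * (eta2 q * q * q * r + 2 * (eta1 q * q * pp d))
      + 2 * d * (eta1 q * q * r)) * X := by
    unfold err
    rw [← hq, e1, ← hX]
    have hMq : M = t / q := by rw [hq]; field_simp
    have : t ≠ 0 := by linarith
    have hq0' : q ≠ 0 := by rw [hq]; positivity
    rw [hrr, hMq]; field_simp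
  rw [e2, abs_mul, abs_of_pos hX0]
  have hXb := pow_bd (d := d) hd hc ht1
  rw [mul_assoc _ ((2:ℝ) ^ ((d:ℝ) / 2))]
  refine mul_le_mul ?_ hXb hX0.le (by positivity)
  refine (abs_add_le _ _).trans ?_
  have k1 : |eta2 q * q * q * r| ≤ 2 * (B * 2 * 2) := by
    rw [abs_mul, abs_mul, abs_mul, abs_of_nonneg hq0, abs_of_nonneg hr0]
    calc |eta2 q| * q * q * r ≤ B * 2 * 2 * 2 := by gcongr; exact h2 q
      _ = _ := by ring
  have k2 : |eta1 q * q * r| ≤ B * 2 * 2 := by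
    rw [abs_mul, abs_mul, abs_of_nonneg hq0, abs_of_nonneg hr0]
    gcongr; exact h1 q
  have k3 : |eta1 q * q * pp d| ≤ B * 2 * |pp d| := by
    rw [abs_mul, abs_mul, abs_of_nonneg hq0]
    gcongr; exact h1 q
  refine add_le_add ?_ ?_
  · rw [abs_mul, abs_of_pos (by norm_num : (0:ℝ) < 4)]
    gcongr
    refine (abs_add_le _ _).trans ?_
    gcongr
    rw [abs_mul, abs_of_pos (by norm_num : (0:ℝ) < 2)]
    gcongr
  · rw [abs_mul, abs_of_nonneg (by positivity : (0:ℝ) ≤ 2 * d)]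
    gcongr

def Gk (z : Ed d) : ℝ := ‖z‖ ^ ((2:ℝ) - d)

def kap (d : ℕ) : ℝ := d * (d - 2) * ∫ x : Ed d, w (d + 2) x

lemma Gk_nonneg (z : Ed d) : 0 ≤ Gk z := by unfold Gk; positivity

lemma Gk_symm (x y : Ed d) : Gk (x - y) = Gk (y - x) := by unfold Gk; rw [norm_sub_rev]

lemma Gk_eq (z : Ed d) : Gk z = (‖z‖ ^ 2) ^ pp d := by
  unfold Gk pp
  rw [← Real.rpow_natCast_mul (norm_nonneg z)]; congr 1; push_cast; ring

lemma Gk_meas : Measurable (Gk : Ed d → ℝ) := by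
  unfold Gk; exact measurable_norm.pow_const _

lemma Gk_locInt (hd : 5 ≤ d) : LocallyIntegrable (Gk : Ed d → ℝ) := by
  refine locallyIntegrable_of_norm_le_rpow (C := 1) (α := (d:ℝ) - 2) (by simp; omega) (by simp)
    (Eventually.of_forall fun x => ?_) Gk_meas.aestronglyMeasurable
  rw [Real.norm_of_nonneg (Gk_nonneg x), one_mul]; unfold Gk
  rw [neg_sub]

lemma kap_pos (hd : 5 ≤ d) : 0 < kap d := by
  have : (5:ℝ) ≤ d := by exact_mod_cast hd
  have h : 0 < ∫ x : Ed d, w (d + 2) x := by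
    rw [integral_pos_iff_support_of_nonneg (fun x => (w_pos _ x).le) (w_int (by linarith))]
    have : Function.support (w ((d:ℝ) + 2) : Ed d → ℝ) = Set.univ := by
      ext x; simp [(w_pos (d + 2) x).ne']
    rw [this]; exact isOpen_univ.measure_pos _ ⟨0, trivial⟩
  unfold kap
  have : (0:ℝ) < d - 2 := by linarith
  positivity

lemma w_shift {b : ℝ} (hb : 0 ≤ b) (x y : Ed d) :
    w b (y - x) ≤ (2 * (1 + ‖x‖ ^ 2)) ^ (b / 2) * w b y := by
  unfold w
  have h1 : (1 + ‖y‖ ^ 2) ≤ (2 * (1 + ‖x‖ ^ 2)) * (1 + ‖y - x‖ ^ 2) := by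
    have : ‖y‖ ≤ ‖x‖ + ‖y - x‖ := by
      have := norm_add_le x (y - x); simpa using this
    have h2 : ‖y‖ ^ 2 ≤ (‖x‖ + ‖y - x‖) ^ 2 := by gcongr
    nlinarith [sq_nonneg (‖x‖ - ‖y - x‖), mul_nonneg (sq_nonneg ‖x‖) (sq_nonneg ‖y - x‖)]
  have h2 : (1 + ‖y - x‖ ^ 2) ^ (-b / 2) ≤ ((1 + ‖y‖ ^ 2) / (2 * (1 + ‖x‖ ^ 2))) ^ (-b / 2) := by
    refine Real.rpow_le_rpow_of_nonpos (by positivity) ?_ (by linarith)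
    rw [div_le_iff₀ (by positivity)]; linarith
  refine h2.trans (le_of_eq ?_)
  rw [Real.div_rpow (by positivity) (by positivity), div_eq_mul_inv, ← Real.rpow_neg (by positivity),
    mul_comm]
  congr 2; ring

/-- Gk is bounded by w away from zero -/
lemma Gk_le_w (hd : 5 ≤ d) {z : Ed d} (hz : 1 ≤ ‖z‖) :
    Gk z ≤ 2 ^ ((d:ℝ) / 2) * w (d - 2) z := by
  have h5 : (5:ℝ) ≤ d := by exact_mod_cast hd
  rw [Gk_eq]; unfold w
  have h1 : (‖z‖ ^ 2) ^ pp d ≤ ((1 + ‖z‖ ^ 2) / 2) ^ pp d := by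
    refine Real.rpow_le_rpow_of_nonpos (by positivity) (by nlinarith) ?_
    unfold pp; linarith
  refine h1.trans ?_
  rw [Real.div_rpow (by positivity) (by norm_num), show pp d = -((d:ℝ) - 2) / 2 by unfold pp; ring,
    div_eq_mul_inv, ← Real.rpow_neg (by norm_num), mul_comm]
  gcongr
  · norm_num
  · linarith

lemma w_le_Gk (hd : 5 ≤ d) {z : Ed d} (hz : z ≠ 0) : w (d - 2) z ≤ Gk z := by
  have h5 : (5:ℝ) ≤ d := by exact_mod_cast hd
  rw [Gk_eq]; unfold w
  rw [show pp d = -((d:ℝ) - 2) / 2 by unfold pp; ring]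
  have : 0 < ‖z‖ := norm_pos_iff.2 hz
  exact Real.rpow_le_rpow_of_nonpos (by positivity) (by linarith) (by linarith)

lemma Gk_int (hd : 5 ≤ d) {F : Ed d → ℝ} (hF : Continuous F)
    (iF : Integrable (fun x => w (d - 2) x * |F x|)) (x : Ed d) :
    Integrable (fun y => Gk (x - y) * F y) := by
  have h5 : (5:ℝ) ≤ d := by exact_mod_cast hd
  have hm : AEStronglyMeasurable (fun y => Gk (x - y) * F y) volume :=
    ((Gk_meas.comp (measurable_const.sub measurable_id)).mul hF.measurable).aestronglyMeasurable
  have hK : IsCompact (Metric.closedBall x 1) := isCompact_closedBall x 1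
  rw [← integrableOn_univ, ← Set.union_compl_self (Metric.closedBall x 1), integrableOn_union]
  constructor
  · have : LocallyIntegrable (fun y => Gk (x - y)) volume := by
      have h1 : LocallyIntegrable (fun y => Gk (y - x)) volume := by
        intro y
        have := (Gk_locInt hd) (y - x)
        obtain ⟨s, hs, hi⟩ := this
        refine ⟨(fun y => y - x) ⁻¹' s, (continuous_id.sub continuous_const).continuousAt.preimage_mem_nhds hs, ?_⟩
        have := (measurePreserving_sub_right (volume : Measure (Ed d)) x).integrableOn_comp_preimage
          (Homeomorph.subRight x).measurableEmbedding (f := Gk) (s := s)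
        exact this.2 hi
      simpa only [Gk_symm x] using h1
    exact (this.integrableOn_isCompact hK).mul_continuousOn hF.continuousOn hK
  · refine Integrable.mono' ((iF.const_mul (2 ^ ((d:ℝ) / 2) * (2 * (1 + ‖x‖ ^ 2)) ^ (((d:ℝ) - 2) / 2))).integrableOn)
      hm.restrict ?_
    refine (ae_restrict_iff' hK.isClosed.measurableSet.compl).2 (Eventually.of_forall fun y hy => ?_)
    have hy' : 1 ≤ ‖y - x‖ := by
      rw [Set.mem_compl_iff, Metric.mem_closedBall, dist_eq_norm] at hy; linarith
    rw [norm_mul, Real.norm_of_nonneg (Gk_nonneg _), Gk_symm, Real.norm_eq_abs, ← mul_assoc]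
    refine mul_le_mul_of_nonneg_right ?_ (abs_nonneg _)
    refine (Gk_le_w hd hy').trans ?_
    rw [mul_assoc]
    gcongr
    exact w_shift (by linarith) x y

lemma rho_scale {N : ℝ} (hN : 0 < N) (z : Ed d) :
    rho d (1 / N ^ 2) (‖z‖ ^ 2) = N ^ d * (d * (d - 2) * w (d + 2) (N • z)) := by
  unfold rho w
  rw [norm_smul, Real.norm_of_nonneg hN.le]
  have e : 1 + (N * ‖z‖) ^ 2 = (1 / N ^ 2 + ‖z‖ ^ 2) * N ^ 2 := by field_simp
  have h1 : 0 < 1 / N ^ 2 + ‖z‖ ^ 2 := by positivity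
  rw [e, Real.mul_rpow h1.le (by positivity), ← Real.rpow_natCast_mul hN.le,
    show pp d - 2 = -((d:ℝ) + 2) / 2 by unfold pp; ring]
  have e2 : N ^ (((2:ℕ):ℝ) * (-((d:ℝ) + 2) / 2)) = (N ^ d)⁻¹ * (1 / N ^ 2) := by
    rw [show ((2:ℕ):ℝ) * (-((d:ℝ) + 2) / 2) = -((d + 2 : ℕ) : ℝ) by push_cast; ring,
      Real.rpow_neg hN.le, Real.rpow_natCast, pow_add]
    field_simp
  rw [e2]; field_simp

lemma peak (hd : 5 ≤ d) {g : Ed d → ℝ} (hg : Continuous g) (ig : Integrable g) (x : Ed d) :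
    Tendsto (fun n : ℕ => ∫ y, rho d (1 / ((n:ℝ) + 1) ^ 2) (‖y - x‖ ^ 2) * g y) atTop
      (𝓝 (kap d * g x)) := by
  have h5 : (5:ℝ) ≤ d := by exact_mod_cast hd
  have hk := kap_pos hd
  have h1 := tendsto_integral_comp_smul_smul_of_integrable' (μ := (volume : Measure (Ed d)))
    (φ := fun x => (kap d)⁻¹ * (d * (d - 2) * w (d + 2) x))
    (fun x => by
      have := w_pos ((d:ℝ) + 2) x
      have : (0:ℝ) < d - 2 := by linarith
      positivity)
    (by rw [integral_const_mul, integral_const_mul]; exact inv_mul_cancel₀ hk.ne')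
    (by
      have h2 : Tendsto (fun x : Ed d => (kap d)⁻¹ * (d * (d - 2)) * w 2 x) (Bornology.cobounded (Ed d)) (𝓝 0) := by
        simpa using (w_tendsto (d := d) (b := 2) two_pos).const_mul ((kap d)⁻¹ * (d * (d - 2)))
      refine squeeze_zero (fun x => ?_) (fun x => ?_) h2
      · have := w_pos ((d:ℝ) + 2) x
        have : (0:ℝ) < d - 2 := by linarith
        positivity
      · have hx : ‖x‖ ^ d ≤ w (-d) x := by
          unfold w
          rw [neg_neg, ← Real.rpow_natCast,
            show (d:ℝ) = ((2:ℕ):ℝ) * ((d:ℝ)/2) by push_cast; ring, Real.rpow_natCast_mul (norm_nonneg x)]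
          push_cast
          rw [show (2:ℝ) * (d / 2) / 2 = d / 2 by ring]
          refine Real.rpow_le_rpow (by positivity) (by linarith) (by positivity)
        have hw : w (-d) x * w (d + 2) x = w 2 x := w_mul' (by ring) x
        rw [← hw]
        have := w_pos ((d:ℝ) + 2) x
        have : (0:ℝ) < d - 2 := by linarith
        rw [finrank_euclideanSpace, Fintype.card_fin]
        calc ‖x‖ ^ d * ((kap d)⁻¹ * (d * (d - 2) * w (d + 2) x))
            ≤ w (-d) x * ((kap d)⁻¹ * (d * (d - 2) * w (d + 2) x)) := by gcongr
          _ = _ := by ring)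
    ig (hg.continuousAt (x := x))
  have h2 : Tendsto (fun n : ℕ => (n:ℝ) + 1) atTop atTop :=
    tendsto_atTop_add_const_right _ _ tendsto_natCast_atTop_atTop
  have h3 := (h1.comp h2).const_mul (kap d)
  refine h3.congr fun n => ?_
  simp only [Function.comp]
  rw [← integral_const_mul]
  congr 1; ext y
  rw [norm_sub_rev, rho_scale (by positivity), finrank_euclideanSpace, Fintype.card_fin, smul_eq_mul]
  field_simp

lemma lap_cont {f : Ed d → ℝ} (hf : ContDiff ℝ 2 f) : Continuous (lap f) := by
  unfold lap
  refine continuous_finsetSum _ fun i _ => ?_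
  have h1 : ContDiff ℝ 1 (fun y => fderiv ℝ f y (EuclideanSpace.single i 1)) :=
    (hf.fderiv_right (m := 1) (by norm_num)).clm_apply contDiff_const
  exact (h1.continuous_fderiv (by norm_num)).clm_apply continuous_const

lemma fn_cd {c M : ℝ} (hc : 0 < c) (x : Ed d) : ContDiff ℝ 2 (fun y => gg d c M (‖y - x‖ ^ 2)) := by
  unfold gg
  have h0 : ContDiff ℝ 2 (fun y : Ed d => ‖y - x‖ ^ 2) := (contDiff_id.sub contDiff_const).norm_sq ℝ
  refine ContDiff.mul ?_ ?_
  · exact (eta_cd (n := 2)).comp (h0.div_const M)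
  · exact (contDiff_const.add h0).rpow_const_of_ne (fun y => by positivity)

lemma fn_hcs {c M : ℝ} (hM : 1 ≤ M) (x : Ed d) : HasCompactSupport (fun y => gg d c M (‖y - x‖ ^ 2)) := by
  refine HasCompactSupport.intro (isCompact_closedBall x (2 * M)) fun y hy => ?_
  have h : 2 * M < ‖y - x‖ := by simpa [dist_eq_norm] using hy
  unfold gg
  rw [eta_zero, zero_mul]
  rw [le_div_iff₀ (by linarith)]; nlinarith

lemma fn_lap {c M : ℝ} (hc : 0 < c) (x y : Ed d) :
    -lap (fun y => gg d c M (‖y - x‖ ^ 2)) y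
      = eta (‖y - x‖ ^ 2 / M) * rho d c (‖y - x‖ ^ 2) - err d c M (‖y - x‖ ^ 2) := by
  rw [radial_lap x y (fun t ht => gg_deriv (by linarith)) (fun t ht => gg1_deriv (by linarith)),
    gg_lap (by positivity)]

lemma rho_bd (hd : 5 ≤ d) {c t : ℝ} (hc : 0 < c) (ht : 1 ≤ t) :
    0 ≤ rho d c t ∧ rho d c t ≤ d * (d - 2) * (2 ^ ((d:ℝ) / 2) * (1 + t) ^ (-(d:ℝ) / 2)) ∧
    rho d c t ≤ d * (d - 2) * c := by
  have hd' : (5:ℝ) ≤ d := by exact_mod_cast hd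
  have h2 : (0:ℝ) < d - 2 := by linarith
  have hct : 0 < c + t := by linarith
  unfold rho
  refine ⟨by positivity, ?_, ?_⟩
  · rw [mul_assoc _ c]
    refine mul_le_mul_of_nonneg_left ?_ (by positivity)
    refine le_trans ?_ (pow_bd hd hc ht)
    have : (c + t) ^ (pp d - 1) = (c + t) * (c + t) ^ (pp d - 2) := by
      rw [← Real.rpow_one_add' hct.le]
      · congr 1; ring
      · unfold pp; intro h; linarith
    rw [this]
    exact mul_le_mul_of_nonneg_right (by linarith) (by positivity)
  · refine mul_le_of_le_one_right (by positivity) ?_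
    exact Real.rpow_le_one_of_one_le_of_nonpos (by linarith) (by unfold pp; linarith)

lemma cn (n : ℕ) : 0 < 1 / ((n:ℝ) + 1) ^ 2 ∧ 1 / ((n:ℝ) + 1) ^ 2 ≤ 1 ∧ 1 ≤ ((n:ℝ) + 1) ^ 2 := by
  have : (1:ℝ) ≤ ((n:ℝ) + 1) ^ 2 := one_le_pow₀ (by linarith [n.cast_nonneg (α := ℝ)])
  refine ⟨by positivity, ?_, this⟩
  rw [div_le_one (by positivity)]; exact this

lemma Mn_top : Tendsto (fun n : ℕ => ((n:ℝ) + 1) ^ 2) atTop atTop :=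
  (tendsto_pow_atTop two_ne_zero).comp (tendsto_atTop_add_const_right _ _ tendsto_natCast_atTop_atTop)

lemma cn_zero : Tendsto (fun n : ℕ => 1 / ((n:ℝ) + 1) ^ 2) atTop (𝓝 0) := by
  simp only [one_div]; exact Mn_top.inv_tendsto_atTop

def rem (φ : Ed d → ℝ) (x : Ed d) (n : ℕ) (y : Ed d) : ℝ :=
  -lap (fun y => gg d (1 / ((n:ℝ) + 1) ^ 2) (((n:ℝ) + 1) ^ 2) (‖y - x‖ ^ 2)) y * φ y
    - rho d (1 / ((n:ℝ) + 1) ^ 2) (‖y - x‖ ^ 2) * (eta (‖y - x‖ ^ 2) * φ y)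

lemma rem_bd (hd : 5 ≤ d) : ∃ D : ℝ, 0 ≤ D ∧ ∀ (φ : Ed d → ℝ) (x : Ed d) (n : ℕ) (y : Ed d),
    |rem φ x n y| ≤ D * (w d (y - x) * |φ y|) := by
  have hd' : (5:ℝ) ≤ d := by exact_mod_cast hd
  have h2 : (0:ℝ) < d - 2 := by linarith
  obtain ⟨C, hC, hE⟩ := err_bd hd
  refine ⟨d * (d - 2) * 2 ^ ((d:ℝ) / 2) + C, by positivity, fun φ x n y => ?_⟩
  obtain ⟨hc, hc1, hM⟩ := cn n
  unfold rem
  rw [fn_lap hc]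
  set c := 1 / ((n:ℝ) + 1) ^ 2
  set M := ((n:ℝ) + 1) ^ 2
  set t := ‖y - x‖ ^ 2 with ht
  have ht0 : 0 ≤ t := by positivity
  have e : (eta (t / M) * rho d c t - err d c M t) * φ y - rho d c t * (eta t * φ y)
      = ((eta (t / M) - eta t) * rho d c t - err d c M t) * φ y := by ring
  rw [e, abs_mul, ← mul_assoc]
  refine mul_le_mul_of_nonneg_right ?_ (abs_nonneg _)
  have hw : w d (y - x) = (1 + t) ^ (-(d:ℝ) / 2) := rfl
  rw [hw]
  rcases lt_or_ge t 1 with h | h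
  · rw [err_zero hM (by linarith), eta_one, eta_one h.le]
    · simp; positivity
    · rw [div_le_one (by linarith)]; linarith
  · obtain ⟨r0, r1, -⟩ := rho_bd hd hc h
    have := hE c M t hc hc1 hM ht0
    have h3 : |eta (t / M) - eta t| ≤ 1 := by
      rw [abs_le]; constructor <;> linarith [eta_nonneg (t / M), eta_le (t / M), eta_nonneg t, eta_le t]
    calc _ ≤ |(eta (t / M) - eta t) * rho d c t| + |err d c M t| := abs_sub _ _
      _ ≤ rho d c t + |err d c M t| := by
        gcongr; rw [abs_mul, abs_of_nonneg r0]; exact mul_le_of_le_one_left r0 h3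
      _ ≤ _ := by rw [add_mul]; linarith

lemma rem_lim (hd : 5 ≤ d) (φ : Ed d → ℝ) (x y : Ed d) :
    Tendsto (fun n => rem φ x n y) atTop (𝓝 0) := by
  have hd' : (5:ℝ) ≤ d := by exact_mod_cast hd
  have h2 : (0:ℝ) < d - 2 := by linarith
  have h0 : Tendsto (fun n : ℕ => d * (d - 2) * (1 / ((n:ℝ) + 1) ^ 2) * |φ y|) atTop (𝓝 0) := by
    simpa using (cn_zero.const_mul ((d:ℝ) * (d - 2))).mul_const |φ y|
  refine squeeze_zero_norm' ?_ h0
  filter_upwards [Mn_top.eventually_gt_atTop (‖y - x‖ ^ 2)] with n hn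
  obtain ⟨hc, hc1, hM⟩ := cn n
  unfold rem
  rw [fn_lap hc, Real.norm_eq_abs]
  set c := 1 / ((n:ℝ) + 1) ^ 2
  set M := ((n:ℝ) + 1) ^ 2
  set t := ‖y - x‖ ^ 2 with ht
  have ht0 : 0 ≤ t := by positivity
  rw [err_zero hM hn, eta_one (s := t / M) (by rw [div_le_one (by linarith)]; linarith)]
  have e : (1 * rho d c t - 0) * φ y - rho d c t * (eta t * φ y)
      = ((1 - eta t) * rho d c t) * φ y := by ring
  rw [e, abs_mul]
  refine mul_le_mul_of_nonneg_right ?_ (abs_nonneg _)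
  rcases lt_or_ge t 1 with h | h
  · rw [eta_one h.le]; simp; positivity
  · obtain ⟨r0, -, r2⟩ := rho_bd hd hc h
    have h3 : 0 ≤ 1 - eta t := by linarith [eta_le t]
    rw [abs_of_nonneg (by positivity)]
    nlinarith [eta_nonneg t]

theorem gk_repr (hd : 5 ≤ d) {φ F : Ed d → ℝ} (hφ : ContDiff ℝ 1 φ) (hF : Continuous F) (h : WE φ F)
    (iφ : Integrable (fun x => w d x * |φ x|)) (iF : Integrable (fun x => w (d - 2) x * |F x|)) (x : Ed d) :
    kap d * φ x = ∫ y, Gk (x - y) * F y := by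
  have hd' : (5:ℝ) ≤ d := by exact_mod_cast hd
  have hpp : pp d ≤ 0 := by unfold pp; linarith
  have : Nonempty (Fin d) := ⟨⟨0, by omega⟩⟩
  have : Nontrivial (Ed d) := inferInstance
  obtain ⟨D, hD, hb⟩ := rem_bd (d := d) hd
  let f : ℕ → Ed d → ℝ := fun n y => gg d (1 / ((n:ℝ) + 1) ^ 2) (((n:ℝ) + 1) ^ 2) (‖y - x‖ ^ 2)
  have e1 : ∀ n, ∫ y, F y * f n y = ∫ y, -lap (f n) y * φ y := fun n => by
    obtain ⟨hc, hc1, hM⟩ := cn n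
    rw [← green (fn_cd hc x) hφ (Or.inl (fn_hcs hM x)), ← h (f n) ((fn_cd hc x).of_le (by norm_num)) (fn_hcs hM x)]
    congr 1; ext y; exact real_inner_comm _ _
  have hgc : Continuous (fun y => eta (‖y - x‖ ^ 2) * φ y) :=
    ((eta_cd (n := 0)).continuous.comp (by fun_prop)).mul hφ.continuous
  have hgs : HasCompactSupport (fun y => eta (‖y - x‖ ^ 2) * φ y) := by
    refine HasCompactSupport.intro (isCompact_closedBall x 2) fun y hy => ?_
    have h : 2 < ‖y - x‖ := by simpa [dist_eq_norm] using hy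
    show eta (‖y - x‖ ^ 2) * φ y = 0
    rw [eta_zero (by nlinarith), zero_mul]
  have ibd : Integrable (fun y => D * (w d (y - x) * |φ y|)) := by
    refine Integrable.const_mul ?_ _
    refine (iφ.const_mul ((2 * (1 + ‖x‖ ^ 2)) ^ ((d:ℝ) / 2))).mono' ?_ (ae_of_all _ fun y => ?_)
    · exact (((w_cont _).comp (by fun_prop)).mul hφ.continuous.abs).aestronglyMeasurable
    · have := w_shift (b := d) (by positivity) x y
      rw [Real.norm_of_nonneg (mul_nonneg (w_pos _ _).le (abs_nonneg _)), ← mul_assoc]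
      gcongr
  have crho : ∀ n : ℕ, Continuous (fun y => rho d (1 / ((n:ℝ) + 1) ^ 2) (‖y - x‖ ^ 2)) := fun n => by
    obtain ⟨hc, hc1, hM⟩ := cn n
    unfold rho
    refine continuous_const.mul ?_
    refine Continuous.rpow_const (by fun_prop) (fun y => Or.inl (by positivity))
  have cR : ∀ n, Continuous (rem φ x n) := fun n => by
    obtain ⟨hc, hc1, hM⟩ := cn n
    exact (((lap_cont (fn_cd hc x)).neg).mul hφ.continuous).sub ((crho n).mul hgc)
  have iR : ∀ n, Integrable (rem φ x n) := fun n =>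
    ibd.mono' (cR n).aestronglyMeasurable (ae_of_all _ fun y => by simpa using hb φ x n y)
  have e2 : ∀ n : ℕ, ∫ y, F y * f n y = (∫ y, rem φ x n y)
      + ∫ y, rho d (1 / ((n:ℝ) + 1) ^ 2) (‖y - x‖ ^ 2) * (eta (‖y - x‖ ^ 2) * φ y) := fun n => by
    rw [e1]
    refine Eq.trans ?_ (integral_add (iR n) (int_of ((crho n).mul hgc) hgs.mul_left))
    congr 1; ext y; show _ = rem φ x n y + rho d (1 / ((n:ℝ) + 1) ^ 2) (‖y - x‖ ^ 2) * (eta (‖y - x‖ ^ 2) * φ y)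
    unfold rem; ring
  have l1 : Tendsto (fun n => ∫ y, rem φ x n y) atTop (𝓝 (∫ y : Ed d, (0:ℝ))) :=
    tendsto_integral_of_dominated_convergence _ (fun n => (cR n).aestronglyMeasurable) ibd
      (fun n => ae_of_all _ fun y => by simpa using hb φ x n y) (ae_of_all _ fun y => rem_lim hd φ x y)
  have l2 := peak hd hgc (int_of hgc hgs) x
  have l3 : Tendsto (fun n => ∫ y, F y * f n y) atTop (𝓝 (∫ y, Gk (x - y) * F y)) := by
    refine tendsto_integral_of_dominated_convergence (fun y => |Gk (x - y) * F y|) (fun n => ?_) (Gk_int hd hF iF x).abs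
      (fun n => ?_) ?_
    · exact (hF.mul (fn_cd (cn n).1 x).continuous).aestronglyMeasurable
    · filter_upwards [compl_mem_ae_iff.2 (measure_singleton x)] with y hy
      obtain ⟨hc, hc1, hM⟩ := cn n
      have hy' : 0 < ‖y - x‖ := norm_pos_iff.2 (sub_ne_zero.2 hy)
      rw [Real.norm_eq_abs, abs_mul, abs_mul, mul_comm]
      refine mul_le_mul_of_nonneg_right ?_ (abs_nonneg _)
      rw [Gk_symm, Gk_eq]
      show |eta _ * _| ≤ _
      rw [abs_mul, abs_of_nonneg (eta_nonneg _), abs_of_nonneg (by positivity), abs_of_nonneg (by positivity)]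
      refine (mul_le_of_le_one_left (by positivity) (eta_le _)).trans ?_
      exact Real.rpow_le_rpow_of_nonpos (by positivity) (by linarith) hpp
    · filter_upwards [compl_mem_ae_iff.2 (measure_singleton x)] with y hy
      have hy' : 0 < ‖y - x‖ := norm_pos_iff.2 (sub_ne_zero.2 hy)
      rw [mul_comm (Gk _)]
      refine Tendsto.const_mul _ ?_
      rw [Gk_symm, Gk_eq]
      have h4 : Tendsto (fun n : ℕ => (1 / ((n:ℝ) + 1) ^ 2 + ‖y - x‖ ^ 2) ^ pp d) atTop (𝓝 ((‖y - x‖ ^ 2) ^ pp d)) := by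
        have : Tendsto (fun n : ℕ => (1 / ((n:ℝ) + 1) ^ 2 + ‖y - x‖ ^ 2)) atTop (𝓝 (‖y - x‖ ^ 2)) := by
          simpa using cn_zero.add_const (‖y - x‖ ^ 2)
        exact this.rpow_const (Or.inl (by positivity))
      refine h4.congr' ?_
      filter_upwards [Mn_top.eventually_gt_atTop (‖y - x‖ ^ 2)] with n hn
      show _ = eta _ * _
      rw [eta_one, one_mul]
      rw [div_le_one (by linarith [(cn n).2.2])]; exact hn.le
  have l4 := l3.congr e2
  have := tendsto_nhds_unique l4 (l1.add l2)
  rw [this]; simp [eta_one]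

lemma lin3 {f g h : Ed d → ℝ} (a b c : ℝ) (hf : Integrable f) (hg : Integrable g) (hh : Integrable h) :
    ∫ x, (a * f x + b * g x + c * h x) = a * (∫ x, f x) + b * (∫ x, g x) + c * ∫ x, h x := by
  have i1 : Integrable (fun x => a * f x + b * g x) := (hf.const_mul a).add (hg.const_mul b)
  rw [integral_add i1 (hh.const_mul c), integral_add (hf.const_mul a) (hg.const_mul b),
    integral_const_mul, integral_const_mul, integral_const_mul]

lemma PB (hd : 5 ≤ d) {b : ℝ} (hb : 0 < b) (hb2 : b < d - 2) (x : Ed d) :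
    Integrable (fun y => Gk (x - y) * w (b + 2) y) ∧
    ∫ y, Gk (x - y) * w (b + 2) y ≤ kap d / (b * (d - 2 - b)) * w b x := by
  have hd' : (5:ℝ) ≤ d := by exact_mod_cast hd
  have hk : 0 < b * (d - 2 - b) := mul_pos hb (by linarith)
  have i0 : Integrable (w (d + b) : Ed d → ℝ) := w_int (by linarith)
  have i1 : Integrable (fun y : Ed d => w (d - 2) y * |w (b + 2) y|) := by
    refine i0.congr (ae_of_all _ fun y => ?_)
    show _ = _ * _
    rw [abs_of_pos (w_pos _ _), w_mul' (c := d + b) (by ring)]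
  have i2 := Gk_int hd (w_cont (b + 2)) i1 x
  refine ⟨i2, ?_⟩
  have hP : ∀ y : Ed d, |Pw b y| ≤ (b * (d - 2 - b) + b * (b + 2)) * w (b + 2) y := fun y => by
    have h0 := Pw_ge hb y
    have h1 := w_anti (show b + 2 ≤ b + 4 by linarith) y
    have h2 := w_pos (b + 2) y
    rw [abs_of_nonneg (le_trans (by positivity) h0)]
    unfold Pw
    rw [add_mul]
    gcongr
  have i3 : Integrable (fun y : Ed d => w (d - 2) y * |Pw b y|) := by
    refine (i1.const_mul (b * (d - 2 - b) + b * (b + 2))).mono' ?_ (ae_of_all _ fun y => ?_)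
    · exact ((w_cont _).mul (Pw_cont b).abs).aestronglyMeasurable
    · have h2 := w_pos (d - 2) y
      rw [Real.norm_of_nonneg (by positivity), abs_of_pos (w_pos (b + 2) y)]
      have := mul_le_mul_of_nonneg_left (hP y) h2.le
      linarith
  have r := gk_repr hd (w_contDiff b) (Pw_cont b) (WE_w b) (by
    refine i0.congr (ae_of_all _ fun y => ?_)
    show _ = _ * _
    rw [abs_of_pos (w_pos _ _), w_mul]) i3 x
  rw [div_mul_eq_mul_div, le_div_iff₀ hk, r, mul_comm, ← integral_const_mul]
  refine integral_mono (i2.const_mul _) (Gk_int hd (Pw_cont b) i3 x) fun y => ?_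
  have := mul_le_mul_of_nonneg_left (Pw_ge hb y) (Gk_nonneg (x - y))
  show _ * (_ * _) ≤ _ * _
  linarith

lemma V_small {V : Ed d → ℝ} {β C₀ : ℝ} (hβ : 3 < β) (hC : 0 < C₀) (hV : ∀ x, |V x| ≤ C₀ * w β x)
    {θ : ℝ} (hθ : 0 < θ) : ∃ ρ : ℝ, 0 < ρ ∧ ∀ x : Ed d, ρ ≤ ‖x‖ → |V x| ≤ θ * w 2 x := by
  have h := (w_tendsto (d := d) one_pos).eventually (gt_mem_nhds (show (0:ℝ) < θ / C₀ by positivity))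
  rw [← comap_norm_atTop] at h
  obtain ⟨s, hs, hs'⟩ := h
  obtain ⟨r, hr⟩ := mem_atTop_sets.1 hs
  refine ⟨max r 1, by positivity, fun x hx => ?_⟩
  have h1 : w 1 x < θ / C₀ := hs' (hr _ ((le_max_left _ _).trans hx))
  rw [lt_div_iff₀ hC] at h1
  have h2 := w_anti (show (3:ℝ) ≤ β by linarith) x
  rw [← w_mul' (show (1:ℝ) + 2 = 3 by norm_num)] at h2
  have h3 := w_pos 2 x
  calc |V x| ≤ C₀ * w β x := hV x
    _ ≤ C₀ * (w 1 x * w 2 x) := by gcongr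
    _ = w 1 x * C₀ * w 2 x := by ring
    _ ≤ _ := by gcongr

lemma cs {f g : Ed d → ℝ} (h1 : Integrable (fun x => f x ^ 2)) (h2 : Integrable (fun x => g x ^ 2))
    (h3 : Integrable (fun x => f x * g x)) :
    (∫ x, f x * g x) ^ 2 ≤ (∫ x, f x ^ 2) * ∫ x, g x ^ 2 := by
  have : ∀ s : ℝ, 0 ≤ (∫ x, f x ^ 2) * (s * s) + (2 * ∫ x, f x * g x) * s + ∫ x, g x ^ 2 := fun s => by
    have e : ∫ x, (s * f x + g x) ^ 2 = (∫ x, f x ^ 2) * (s * s) + (2 * ∫ x, f x * g x) * s + ∫ x, g x ^ 2 := by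
      have : (fun x => (s * f x + g x) ^ 2) = fun x => (s * s) * f x ^ 2 + (2 * s) * (f x * g x) + 1 * g x ^ 2 := by
        ext x; ring
      rw [this, lin3 _ _ _ h1 h3 h2]; ring
    rw [← e]; exact integral_nonneg fun x => sq_nonneg _
  have := discrim_le_zero this
  unfold discrim at this
  nlinarith

lemma lap_hcs {v : Ed d → ℝ} (hc : HasCompactSupport v) : HasCompactSupport (lap v) := by
  refine HasCompactSupport.intro hc fun x hx => ?_
  unfold lap
  refine Finset.sum_eq_zero fun i _ => ?_
  have h1 : ∀ y ∉ tsupport v, (fun y => fderiv ℝ v y (EuclideanSpace.single i 1)) y = 0 := fun y hy => by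
    have : fderiv ℝ v y = 0 := by
      by_contra h
      exact hy (tsupport_fderiv_subset ℝ (subset_tsupport _ h))
    simp [this]
  have h2 : (fun y => fderiv ℝ v y (EuclideanSpace.single i 1)) =ᶠ[𝓝 x] fun _ => (0:ℝ) := by
    filter_upwards [(isClosed_tsupport v).isOpen_compl.mem_nhds hx] with y hy using h1 y hy
  rw [h2.fderiv_eq]; simp

lemma Q_bilin {V u v : Ed d → ℝ} (hV : Continuous V) (hQ : ∀ u, IsTest u → 0 ≤ Qf V u)
    (hu : IsTest u) (hv : IsTest v) :
    (∫ x, (-lap v x + V x * v x) * u x) ^ 2 ≤ Qf V u * Qf V v := by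
  have hv2 : ContDiff ℝ 2 v := hv.1.of_le (WithTop.coe_le_coe.2 (le_top : (2:ℕ∞) ≤ ⊤))
  have j1 : Integrable (fun x => inner ℝ (gradient u x) (gradient v x)) := inner_int hu.c1 hv.c1 hv.2
  have j2 : Integrable (fun x => V x * u x * v x) := int_mul (hV.mul hu.c1.continuous) hv.c1.continuous hv.2
  have e0 : ∫ x, (-lap v x + V x * v x) * u x
      = (∫ x, inner ℝ (gradient u x) (gradient v x)) + ∫ x, V x * u x * v x := by
    have := green hv2 hu.c1 (Or.inl hv.2)
    have e : ∫ x, inner ℝ (gradient u x) (gradient v x) = ∫ x, -lap v x * u x := by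
      rw [← this]; congr 1; ext x; exact real_inner_comm _ _
    have j3 : Integrable (fun x => -lap v x * u x) := int_mul (lap_cont hv2).neg hu.c1.continuous hu.2
    rw [e, ← integral_add j3 j2]
    congr 1; ext x; ring
  obtain ⟨u1, u2⟩ := Q_int hV hu.c1 hu.2
  obtain ⟨v1, v2⟩ := Q_int hV hv.c1 hv.2
  have key : ∀ s : ℝ, 0 ≤ Qf V v * (s * s) + (2 * ∫ x, (-lap v x + V x * v x) * u x) * s + Qf V u := fun s => by
    have ht : IsTest (fun x => u x + s * v x) := by
      refine ⟨hu.1.add (contDiff_const.mul hv.1), hu.2.add hv.2.mul_left⟩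
    have e1 : ∀ x, ‖gradient (fun x => u x + s * v x) x‖ ^ 2 =
        1 * ‖gradient u x‖ ^ 2 + (2 * s) * inner ℝ (gradient u x) (gradient v x) + (s * s) * ‖gradient v x‖ ^ 2 := fun x => by
      rw [grad_add hu.c1 (contDiff_const.mul hv.c1), grad_cmul s hv.c1, norm_add_sq_real, norm_smul, inner_smul_right,
        Real.norm_eq_abs, mul_pow, sq_abs]; ring
    have e2 : ∀ x, V x * (u x + s * v x) ^ 2 =
        1 * (V x * u x ^ 2) + (2 * s) * (V x * u x * v x) + (s * s) * (V x * v x ^ 2) := fun x => by ring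
    have := hQ _ ht
    rw [Q_split hV ht.c1 ht.2] at this
    simp only [e1, e2] at this
    rw [lin3 _ _ _ u1 j1 v1, lin3 _ _ _ u2 j2 v2] at this
    rw [e0, Q_split hV hu.c1 hu.2, Q_split hV hv.c1 hv.2]
    linarith
  have := discrim_le_zero key
  unfold discrim at this
  nlinarith

lemma gs_WE {V φ : Ed d → ℝ} (hV : Continuous V) (hQ : ∀ u, IsTest u → 0 ≤ Qf V u)
    (hg : GroundState V φ) : WE φ (fun x => -(V x * φ x)) := by
  obtain ⟨hφ, hpos, un, ⟨ht, h0, -, hl⟩, hK⟩ := hg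
  refine WE_of_test hφ (hV.mul hφ.continuous).neg fun v hv => ?_
  have hv2 : ContDiff ℝ 2 v := hv.1.of_le (WithTop.coe_le_coe.2 (le_top : (2:ℕ∞) ≤ ⊤))
  set h : Ed d → ℝ := fun x => -lap v x + V x * v x with hh
  have hc : Continuous h := (lap_cont hv2).neg.add (hV.mul hv.c1.continuous)
  have hs : HasCompactSupport h := (lap_hcs hv.2).neg.add hv.2.mul_left
  have hs2 : HasCompactSupport (fun x => h x ^ 2) := by
    have := hs.mul_left (f := h)
    simp only [pow_two]; exact this
  set K := tsupport h
  have hKc : IsCompact K := hs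
  have iφ := int_mul hφ.continuous hc hs
  have b : ∀ n, (∫ x, h x * φ x) ^ 2 ≤ 2 * (Qf V (un n) * Qf V v)
      + 2 * ((∫ x, h x ^ 2) * ∫ x in K, (un n x - φ x) ^ 2) := fun n => by
    have b1 := Q_bilin hV hQ (ht n) hv
    have ec : Continuous (fun x => un n x - φ x) := (ht n).c1.continuous.sub hφ.continuous
    have b2 := cs (f := h) (g := K.indicator (fun x => un n x - φ x)) (int_of (hc.pow 2) hs2)
      (by
        have : (fun x => K.indicator (fun x => un n x - φ x) x ^ 2) = K.indicator (fun x => (un n x - φ x) ^ 2) := by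
          ext x; by_cases hx : x ∈ K <;> simp [hx]
        rw [this, integrable_indicator_iff hKc.measurableSet]
        exact (ec.pow 2).continuousOn.integrableOn_compact hKc)
      (by
        have : (fun x => h x * K.indicator (fun x => un n x - φ x) x) = fun x => (un n x - φ x) * h x := by
          ext x; by_cases hx : x ∈ K
          · simp [hx]; ring
          · have : h x = 0 := image_eq_zero_of_notMem_tsupport hx
            simp [this]
        rw [this]; exact int_mul ec hc hs)
    have e1 : ∫ x, h x * K.indicator (fun x => un n x - φ x) x = (∫ x, h x * un n x) - ∫ x, h x * φ x := by
      rw [← integral_sub]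
      · congr 1; ext x; by_cases hx : x ∈ K
        · simp [hx]; ring
        · have : h x = 0 := image_eq_zero_of_notMem_tsupport hx
          simp [this]
      · exact (int_mul (ht n).c1.continuous hc hs).congr (ae_of_all _ fun x => mul_comm _ _)
      · exact iφ.congr (ae_of_all _ fun x => mul_comm _ _)
    have e2 : ∫ x, K.indicator (fun x => un n x - φ x) x ^ 2 = ∫ x in K, (un n x - φ x) ^ 2 := by
      rw [← integral_indicator hKc.measurableSet]
      congr 1; ext x; by_cases hx : x ∈ K <;> simp [hx]
    rw [e1, e2] at b2
    nlinarith [sq_nonneg ((∫ x, h x * un n x) + ((∫ x, h x * un n x) - ∫ x, h x * φ x))]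
  have l : Tendsto (fun n => 2 * (Qf V (un n) * Qf V v)
      + 2 * ((∫ x, h x ^ 2) * ∫ x in K, (un n x - φ x) ^ 2)) atTop (𝓝 0) := by
    simpa using ((hl.mul_const (Qf V v)).const_mul 2).add (((hK K hKc).const_mul (∫ x, h x ^ 2)).const_mul 2)
  have z : (∫ x, h x * φ x) ^ 2 ≤ 0 := ge_of_tendsto' l b
  have z' : ∫ x, h x * φ x = 0 := by nlinarith
  have j1 : Integrable (fun x => -lap v x * φ x) :=
    int_of ((lap_cont hv2).neg.mul hφ.continuous) ((lap_hcs hv.2).neg.mul_right)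
  have j2 : Integrable (fun x => V x * φ x * v x) := int_mul (hV.mul hφ.continuous) hv.c1.continuous hv.2
  have e : ∫ x, h x * φ x = (∫ x, -lap v x * φ x) + ∫ x, V x * φ x * v x := by
    rw [← integral_add j1 j2]; congr 1; ext x; simp only [hh]; ring
  have g := green hv2 hφ (Or.inl hv.2)
  have : ∫ x, inner ℝ (gradient φ x) (gradient v x) = ∫ x, -lap v x * φ x := by
    rw [← g]; congr 1; ext x; exact real_inner_comm _ _
  rw [this]
  have e3 : ∫ x, -(V x * φ x) * v x = -∫ x, V x * φ x * v x := by
    rw [← integral_neg]; congr 1; ext x; ring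
  rw [e3]; linarith

lemma gs_int {V φ : Ed d → ℝ} {β C₀ : ℝ} (hd : 5 ≤ d) (hV : Continuous V) (hβ : 3 < β) (hC : 0 < C₀)
    (hVb : ∀ x, |V x| ≤ C₀ * w β x) (hg : GroundState V φ) : Integrable (fun x => w 2 x * φ x ^ 2) := by
  obtain ⟨hφ, hpos, un, ⟨ht, h0, -, hl⟩, hK⟩ := hg
  obtain ⟨ρ, hρ, hs⟩ := V_small hβ hC hVb (θ := 1 / 2) (by norm_num)
  set B := Metric.closedBall (0 : Ed d) ρ
  have hB : IsCompact B := isCompact_closedBall 0 ρ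
  have cφ := hφ.continuous
  have cu : ∀ n, Continuous (un n) := fun n => (ht n).c1.continuous
  have split : ∀ (K : Set (Ed d)), IsCompact K → ∀ n, (∫ x in K, un n x ^ 2) ≤
      2 * (∫ x in K, (un n x - φ x) ^ 2) + 2 * ∫ x in K, φ x ^ 2 := fun K hKc n => by
    have i1 : IntegrableOn (fun x => (un n x - φ x) ^ 2) K :=
      ((((cu n).sub cφ).pow 2).continuousOn).integrableOn_compact hKc
    have i2 : IntegrableOn (fun x => φ x ^ 2) K := ((cφ.pow 2).continuousOn).integrableOn_compact hKc
    have i3 : IntegrableOn (fun x => un n x ^ 2) K := (((cu n).pow 2).continuousOn).integrableOn_compact hKc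
    rw [← integral_const_mul, ← integral_const_mul, ← integral_add (i1.const_mul 2) (i2.const_mul 2)]
    refine integral_mono i3 ((i1.const_mul 2).add (i2.const_mul 2)) fun x => ?_
    show un n x ^ 2 ≤ 2 * (un n x - φ x) ^ 2 + 2 * φ x ^ 2
    nlinarith [sq_nonneg (un n x - 2 * φ x)]
  have hw2 : ∀ n, ∫ x, w 2 x * un n x ^ 2 ≤ 2 * Qf V (un n) + 2 * C₀ * ∫ x in B, un n x ^ 2 := fun n => by
    have hh := hardy hd (ht n).c1 (ht n).2
    obtain ⟨i1, i2⟩ := Q_int hV (ht n).c1 (ht n).2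
    have i3 := (Q_int (w_cont 2) (ht n).c1 (ht n).2).2
    have i4 : Integrable (B.indicator (fun x => un n x ^ 2)) := by
      rw [integrable_indicator_iff hB.measurableSet]
      exact (((cu n).pow 2).continuousOn).integrableOn_compact hB
    rw [Q_split hV (ht n).c1 (ht n).2]
    have : -(∫ x, V x * un n x ^ 2) ≤ (1/2) * (∫ x, w 2 x * un n x ^ 2) + C₀ * ∫ x in B, un n x ^ 2 := by
      rw [← integral_neg, ← integral_indicator hB.measurableSet, ← integral_const_mul, ← integral_const_mul,
        ← integral_add (i3.const_mul _) (i4.const_mul _)]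
      refine integral_mono i2.neg ((i3.const_mul _).add (i4.const_mul _)) fun x => ?_
      show -(V x * un n x ^ 2) ≤ 1/2 * (w 2 x * un n x ^ 2) + C₀ * B.indicator (fun x => un n x ^ 2) x
      have a1 := neg_abs_le (V x)
      have a2 := w_pos 2 x
      have a3 := sq_nonneg (un n x)
      by_cases hx : x ∈ B
      · simp only [hx, Set.indicator_of_mem]
        have : |V x| ≤ C₀ := (hVb x).trans (mul_le_of_le_one_right hC.le (w_le_one (by linarith) x))
        have : 0 ≤ w 2 x * un n x ^ 2 := by positivity
        nlinarith
      · simp only [hx, not_false_eq_true, Set.indicator_of_notMem]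
        have hx' : ρ < ‖x‖ := by simpa [B] using hx
        have := hs x hx'.le
        nlinarith
    linarith
  have ev1 := hl.eventually (gt_mem_nhds one_pos)
  have ev2 := (hK B hB).eventually (gt_mem_nhds one_pos)
  set M := 2 + 2 * C₀ * (2 + 2 * ∫ x in B, φ x ^ 2) with hM
  have bd : ∀ r : ℝ, ∫ x in Metric.closedBall (0 : Ed d) r, w 2 x * φ x ^ 2 ≤ 2 + 2 * M := fun r => by
    set K := Metric.closedBall (0 : Ed d) r
    have hKc : IsCompact K := isCompact_closedBall 0 r
    obtain ⟨n, n1, n2, n3⟩ := (ev1.and (ev2.and ((hK K hKc).eventually (gt_mem_nhds one_pos)))).exists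
    have s := split B hB n
    have h := hw2 n
    have i1 : IntegrableOn (fun x => (un n x - φ x) ^ 2) K :=
      ((((cu n).sub cφ).pow 2).continuousOn).integrableOn_compact hKc
    have i2 : IntegrableOn (fun x => w 2 x * φ x ^ 2) K :=
      (((w_cont 2).mul (cφ.pow 2)).continuousOn).integrableOn_compact hKc
    have i3 : Integrable (fun x => w 2 x * un n x ^ 2) := (Q_int (w_cont 2) (ht n).c1 (ht n).2).2
    have a : ∫ x in K, w 2 x * φ x ^ 2 ≤ 2 * (∫ x in K, (un n x - φ x) ^ 2) + 2 * ∫ x in K, w 2 x * un n x ^ 2 := by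
      rw [← integral_const_mul, ← integral_const_mul, ← integral_add (i1.const_mul 2) (i3.integrableOn.const_mul 2)]
      refine integral_mono i2 ((i1.const_mul 2).add (i3.integrableOn.const_mul 2)) fun x => ?_
      show w 2 x * φ x ^ 2 ≤ 2 * (un n x - φ x) ^ 2 + 2 * (w 2 x * un n x ^ 2)
      have a1 := w_pos 2 x
      have a2 := w_le_one (b := 2) (by norm_num) x
      have : φ x ^ 2 ≤ 2 * (un n x - φ x) ^ 2 + 2 * un n x ^ 2 := by nlinarith [sq_nonneg (2 * un n x - φ x)]
      nlinarith [sq_nonneg (un n x - φ x)]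
    have a' : ∫ x in K, w 2 x * un n x ^ 2 ≤ ∫ x, w 2 x * un n x ^ 2 :=
      setIntegral_le_integral i3 (ae_of_all _ fun x => mul_nonneg (w_pos _ _).le (sq_nonneg _))
    have : 2 * C₀ * ∫ x in B, un n x ^ 2 ≤ 2 * C₀ * (2 + 2 * ∫ x in B, φ x ^ 2) := by
      gcongr; linarith
    linarith
  refine (aecover_closedBall (x := (0 : Ed d)) (tendsto_id (α := ℝ) (x := atTop))).integrable_of_integral_bounded_of_nonneg_ae
    (2 + 2 * M) (fun r => ?_) (ae_of_all _ fun x => mul_nonneg (w_pos _ _).le (sq_nonneg _)) (Eventually.of_forall fun r => bd r)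
  exact (((w_cont 2).mul (cφ.pow 2)).continuousOn).integrableOn_compact (isCompact_closedBall _ _)

lemma bd_ball {f g : Ed d → ℝ} (hf : Continuous f) (hg : Continuous g) (hp : ∀ x, 0 < g x) (ρ : ℝ) :
    ∃ A : ℝ, 0 ≤ A ∧ ∀ x, ‖x‖ ≤ ρ → f x ≤ A * g x := by
  have hc : Continuous (fun x => f x / g x) := hf.div hg fun x => (hp x).ne'
  obtain ⟨A, hA⟩ := (isCompact_closedBall (0 : Ed d) ρ).bddAbove_image hc.continuousOn
  refine ⟨max A 0, le_max_right _ _, fun x hx => ?_⟩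
  have : f x / g x ≤ A := hA ⟨x, by simpa using hx, rfl⟩
  rw [← div_le_iff₀ (hp x)]
  exact this.trans (le_max_left _ _)

lemma T_arg (hd : 5 ≤ d) {b θ : ℝ} (hb : 0 < b) (hb2 : b < d - 2) (hθ : 0 < θ)
    (hθ2 : θ / (b * (d - 2 - b)) ≤ 1 / 2) {z : Ed d → ℝ} (hz : Continuous z) (hz0 : ∀ x, 0 ≤ z x)
    (iz : Integrable (fun x => w (b + 2) x * z x))
    (hi : ∀ x, Integrable (fun y => Gk (x - y) * (w 2 y * z y)))
    (h : ∀ x, kap d * z x ≤ θ * ∫ y, Gk (x - y) * (w 2 y * z y)) : ∀ x, z x = 0 := by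
  have hk := kap_pos hd
  have hkb : 0 < b * (d - 2 - b) := mul_pos hb (by linarith)
  set I := ∫⁻ x, ENNReal.ofReal (w (b + 2) x * z x) with hI
  have hIf : I ≠ ⊤ := by
    have := iz.lintegral_lt_top
    exact this.ne
  have m1 : Measurable (Function.uncurry fun x y : Ed d => ENNReal.ofReal (w (b + 2) x * (θ * (Gk (x - y) * (w 2 y * z y))))) := by
    refine ENNReal.measurable_ofReal.comp ?_
    refine ((w_cont _).measurable.comp measurable_fst).mul (measurable_const.mul ?_)
    refine (Gk_meas.comp (measurable_fst.sub measurable_snd)).mul ?_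
    exact ((w_cont _).measurable.comp measurable_snd).mul (hz.measurable.comp measurable_snd)
  have s1 : ∫⁻ x, ENNReal.ofReal (kap d * (w (b + 2) x * z x)) ≤
      ∫⁻ x, ∫⁻ y, ENNReal.ofReal (w (b + 2) x * (θ * (Gk (x - y) * (w 2 y * z y)))) := by
    refine lintegral_mono fun x => ?_
    have p := w_pos (b + 2) x
    show _ ≤ ∫⁻ y, ENNReal.ofReal (w (b + 2) x * (θ * (Gk (x - y) * (w 2 y * z y))))
    rw [← ofReal_integral_eq_lintegral_ofReal (((hi x).const_mul θ).const_mul _)]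
    · rw [integral_const_mul, integral_const_mul]
      refine ENNReal.ofReal_le_ofReal ?_
      have := mul_le_mul_of_nonneg_left (h x) p.le
      linarith
    · exact ae_of_all _ fun y => mul_nonneg p.le (mul_nonneg hθ.le (mul_nonneg (Gk_nonneg _) (mul_nonneg (w_pos _ _).le (hz0 y))))
  rw [lintegral_lintegral_swap m1.aemeasurable] at s1
  have s2 : ∀ y, ∫⁻ x, ENNReal.ofReal (w (b + 2) x * (θ * (Gk (x - y) * (w 2 y * z y)))) ≤
      ENNReal.ofReal ((kap d / 2) * (w (b + 2) y * z y)) := fun y => by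
    obtain ⟨j1, j2⟩ := PB hd hb hb2 y
    have e : ∀ x, w (b + 2) x * (θ * (Gk (x - y) * (w 2 y * z y))) = (θ * (w 2 y * z y)) * (Gk (y - x) * w (b + 2) x) := fun x => by
      rw [Gk_symm]; ring
    have p := w_pos 2 y
    have q := hz0 y
    simp only [e]
    rw [← ofReal_integral_eq_lintegral_ofReal (j1.const_mul _)]
    · rw [integral_const_mul]
      refine ENNReal.ofReal_le_ofReal ?_
      refine (mul_le_mul_of_nonneg_left j2 (by positivity)).trans ?_
      have e2 : θ * (w 2 y * z y) * (kap d / (b * (d - 2 - b)) * w b y) = (θ / (b * (d - 2 - b))) * (kap d * (w (b + 2) y * z y)) := by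
        rw [← w_mul b 2]; ring
      rw [e2]
      have : 0 ≤ kap d * (w (b + 2) y * z y) := mul_nonneg hk.le (mul_nonneg (w_pos _ _).le q)
      nlinarith
    · exact ae_of_all _ fun x => mul_nonneg (by positivity) (mul_nonneg (Gk_nonneg _) (w_pos _ _).le)
  have s3 := s1.trans (lintegral_mono s2)
  have mm : Measurable (fun x => ENNReal.ofReal (w (b + 2) x * z x)) :=
    ENNReal.measurable_ofReal.comp ((w_cont _).mul hz).measurable
  have e3 : ∀ c : ℝ, 0 ≤ c → ∫⁻ x, ENNReal.ofReal (c * (w (b + 2) x * z x)) = ENNReal.ofReal c * I := fun c hc => by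
    rw [hI, ← lintegral_const_mul _ mm]
    congr 1; ext x; rw [ENNReal.ofReal_mul hc]
  rw [e3 _ hk.le, e3 _ (by positivity)] at s3
  have I0 : I = 0 := by
    have t : I = ENNReal.ofReal I.toReal := (ENNReal.ofReal_toReal hIf).symm
    rw [t, ← ENNReal.ofReal_mul hk.le, ← ENNReal.ofReal_mul (by positivity)] at s3
    have t2 : 0 ≤ I.toReal := ENNReal.toReal_nonneg
    rw [ENNReal.ofReal_le_ofReal_iff (by positivity)] at s3
    have : I.toReal = 0 := by nlinarith
    rw [t, this]; simp
  rw [hI, lintegral_eq_zero_iff mm] at I0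
  have z0 : ∀ᵐ x : Ed d, z x = 0 := by
    filter_upwards [I0] with x hx
    have : w (b + 2) x * z x ≤ 0 := by simpa using hx
    have p := w_pos (b + 2) x
    have q := hz0 x
    nlinarith
  intro x
  have hx := h x
  have : ∫ y, Gk (x - y) * (w 2 y * z y) = 0 := by
    refine (integral_congr_ae (g := fun _ => (0:ℝ)) ?_).trans (by simp)
    filter_upwards [z0] with y hy
    simp [hy]
  rw [this] at hx
  have := hz0 x
  nlinarith

/-- Bundle of facts about a ground state. -/
structure GS (V φ : Ed d → ℝ) (β C₀ : ℝ) : Prop where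
  hV : Continuous V
  hβ : (d:ℝ) - 2 < β
  hC : 0 < C₀
  hVb : ∀ x, |V x| ≤ C₀ * w β x
  hφ : ContDiff ℝ 1 φ
  pos : ∀ x, 0 < φ x
  we : WE φ (fun x => -(V x * φ x))
  int2 : Integrable (fun x => w 2 x * φ x ^ 2)

lemma GS.of {V : Ed d → ℝ} {β C₀ : ℝ} (hd : 5 ≤ d) (hV : Continuous V) (hβ : (d:ℝ) - 2 < β) (hC : 0 < C₀)
    (hVb : ∀ x, |V x| ≤ C₀ * w β x) (hc : Crit V) : ∃ φ, GS V φ β C₀ := by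
  have hd' : (5:ℝ) ≤ d := by exact_mod_cast hd
  obtain ⟨hQ, φ, hg⟩ := hc
  exact ⟨φ, hV, hβ, hC, hVb, hg.1, hg.2.1, gs_WE hV hQ hg, gs_int hd hV (by linarith) hC hVb hg⟩

lemma GS.V3 {V φ : Ed d → ℝ} {β C₀ : ℝ} (hd : 5 ≤ d) (h : GS V φ β C₀) (x : Ed d) : |V x| ≤ C₀ * w 3 x := by
  have hd' : (5:ℝ) ≤ d := by exact_mod_cast hd
  have := h.hC
  have h1 := w_anti (show (3:ℝ) ≤ β by linarith [h.hβ]) x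
  exact (h.hVb x).trans (by gcongr)

lemma GS.int_w {V φ : Ed d → ℝ} {β C₀ : ℝ} (hd : 5 ≤ d) (h : GS V φ β C₀) :
    Integrable (fun x => w (d - 5/2 + 2) x * φ x) := by
  have hd' : (5:ℝ) ≤ d := by exact_mod_cast hd
  have i : Integrable (fun x : Ed d => w 2 x * φ x ^ 2 + w (2 * d - 3) x) :=
    h.int2.add (w_int (by linarith))
  refine i.mono' ((w_cont _).mul h.hφ.continuous).aestronglyMeasurable (ae_of_all _ fun x => ?_)
  have p := h.pos x
  have p1 := w_pos 1 x
  have p2 := w_pos (d - 3/2) x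
  rw [Real.norm_of_nonneg (mul_nonneg (w_pos _ _).le p.le)]
  rw [← w_mul' (show (1:ℝ) + 1 = 2 by norm_num), ← w_mul' (show ((d:ℝ) - 3/2) + (d - 3/2) = 2 * d - 3 by ring),
    ← w_mul' (show (1:ℝ) + (d - 3/2) = d - 5/2 + 2 by ring)]
  nlinarith [sq_nonneg (w 1 x * φ x - w (d - 3/2) x), sq_nonneg (w 1 x * φ x), sq_nonneg (w (d - 3/2) x)]

lemma int_dom {f g : Ed d → ℝ} {A : ℝ} (hg : Integrable g) (hf : Continuous f) (h : ∀ x, |f x| ≤ A * g x) : Integrable f :=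
  (hg.const_mul A).mono' hf.aestronglyMeasurable (ae_of_all _ h)

lemma GS.repr {V φ : Ed d → ℝ} {β C₀ : ℝ} (hd : 5 ≤ d) (h : GS V φ β C₀) :
    Integrable (fun x => w (d - 2) x * |-(V x * φ x)|) ∧
    ∀ x, kap d * φ x = ∫ y, Gk (x - y) * -(V y * φ y) := by
  have hd' : (5:ℝ) ≤ d := by exact_mod_cast hd
  have cφ := h.hφ.continuous
  have i0 := h.int_w hd
  have hC := h.hC
  have i2 : Integrable (fun x => w (d - 2) x * |-(V x * φ x)|) := by
    refine int_dom (A := C₀) i0 ((w_cont _).mul (h.hV.mul cφ).neg.abs) fun x => ?_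
    have p := h.pos x
    have p1 := w_pos (d - 2) x
    rw [abs_of_nonneg (by positivity), abs_neg, abs_mul, abs_of_pos p]
    have a := h.V3 hd x
    have b := w_anti (show (d:ℝ) - 5/2 + 2 ≤ (d - 2) + 3 by linarith) x
    rw [← w_mul] at b
    calc _ ≤ w (d - 2) x * (C₀ * w 3 x * φ x) := by gcongr
      _ = C₀ * ((w (d - 2) x * w 3 x) * φ x) := by ring
      _ ≤ _ := by gcongr
  refine ⟨i2, gk_repr hd h.hφ (h.hV.mul cφ).neg h.we ?_ i2⟩
  refine int_dom (A := 1) i0 ((w_cont _).mul cφ.abs) fun x => ?_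
  have p := h.pos x
  have p1 := w_pos d x
  have b := w_anti (show (d:ℝ) - 5/2 + 2 ≤ d by linarith) x
  rw [abs_of_nonneg (by positivity), abs_of_pos p, one_mul]
  gcongr

lemma GS.decay1 {V φ : Ed d → ℝ} {β C₀ : ℝ} (hd : 5 ≤ d) (h : GS V φ β C₀) :
    ∃ M : ℝ, 0 ≤ M ∧ ∀ x, φ x ≤ M * w (d - 5/2) x := by
  have hd' : (5:ℝ) ≤ d := by exact_mod_cast hd
  have cφ := h.hφ.continuous
  have i0 := h.int_w hd
  have hC := h.hC
  have hk := kap_pos hd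
  obtain ⟨i2, hr⟩ := h.repr hd
  set b : ℝ := d - 5/2 with hb
  have hb0 : 0 < b := by linarith
  have hb2 : b < d - 2 := by linarith
  have hD : 0 < b * (d - 2 - b) := mul_pos hb0 (by linarith)
  set D := b * (d - 2 - b) with hDd
  set θ := D / 2 with hθd
  have hθ : 0 < θ := by positivity
  obtain ⟨ρ, hρ, hs⟩ := V_small (by linarith [h.hβ]) hC h.hVb hθ
  obtain ⟨A, hA, hAb⟩ := bd_ball (f := fun x => |V x| * φ x) (h.hV.abs.mul cφ) (w_cont (b + 2)) (fun x => w_pos _ x) ρ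
  have hall : ∀ y, |V y| * φ y ≤ θ * (w 2 y * φ y) + A * w (b + 2) y := fun y => by
    have p := h.pos y
    have p1 := w_pos 2 y
    have p2 := w_pos (b + 2) y
    rcases le_total ‖y‖ ρ with hy | hy
    · have := hAb y hy
      have : 0 ≤ θ * (w 2 y * φ y) := by positivity
      linarith
    · have := mul_le_mul_of_nonneg_right (hs y hy) p.le
      have : 0 ≤ A * w (b + 2) y := by positivity
      linarith
  set M := 2 * A / D with hM
  have hM0 : 0 ≤ M := by positivity
  refine ⟨M, hM0, ?_⟩
  set z : Ed d → ℝ := fun x => max (φ x - M * w b x) 0 with hz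
  have hzc : Continuous z := (cφ.sub (continuous_const.mul (w_cont b))).max continuous_const
  have hz0 : ∀ x, 0 ≤ z x := fun x => le_max_right _ _
  have hzφ : ∀ x, z x ≤ φ x := fun x => max_le (by nlinarith [w_pos b x]) (h.pos x).le
  have iz : Integrable (fun x => w (b + 2) x * z x) := int_dom (A := 1) i0 ((w_cont _).mul hzc) fun x => by
    have := w_pos (b + 2) x
    have := hz0 x
    rw [abs_of_nonneg (by positivity), one_mul]
    gcongr; exact hzφ x
  have hi : ∀ x, Integrable (fun y => Gk (x - y) * (w 2 y * z y)) := fun x => by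
    refine Gk_int hd ((w_cont _).mul hzc) ?_ x
    refine int_dom (A := 1) iz ((w_cont _).mul ((w_cont _).mul hzc).abs) fun x => ?_
    have p1 := w_pos (d - 2) x
    have p2 := w_pos 2 x
    have := hz0 x
    show abs (w (d - 2) x * abs (w 2 x * z x)) ≤ 1 * (w (b + 2) x * z x)
    rw [abs_of_nonneg (by positivity), abs_of_nonneg (by positivity), one_mul, ← mul_assoc, w_mul' (show (d:ℝ) - 2 + 2 = d by ring)]
    gcongr
    exact w_anti (by linarith) x
  have key := T_arg hd hb0 hb2 hθ (by rw [hθd, ← hDd]; exact (by field_simp : D / 2 / D = 1/2).le) hzc hz0 iz hi fun x => by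
    obtain ⟨j1, j2⟩ := PB hd hb0 hb2 x
    have nn : 0 ≤ θ * ∫ y, Gk (x - y) * (w 2 y * z y) :=
      mul_nonneg hθ.le (integral_nonneg fun y => mul_nonneg (Gk_nonneg _) (mul_nonneg (w_pos _ _).le (hz0 y)))
    have up : kap d * φ x ≤ θ * (∫ y, Gk (x - y) * (w 2 y * z y)) + (θ * M + A) * ∫ y, Gk (x - y) * w (b + 2) y := by
      rw [hr x, ← integral_const_mul, ← integral_const_mul, ← integral_add ((hi x).const_mul _) (j1.const_mul _)]
      refine integral_mono (Gk_int hd (h.hV.mul cφ).neg i2 x) (((hi x).const_mul _).add (j1.const_mul _)) fun y => ?_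
      show Gk (x - y) * -(V y * φ y) ≤ θ * (Gk (x - y) * (w 2 y * z y)) + (θ * M + A) * (Gk (x - y) * w (b + 2) y)
      have g := Gk_nonneg (x - y)
      have t1 : -(V y * φ y) ≤ |V y| * φ y := by
        have := neg_abs_le (V y); nlinarith [h.pos y]
      have t2 : φ y ≤ z y + M * w b y := by
        have : φ y - M * w b y ≤ z y := le_max_left _ _
        linarith
      have t3 : θ * (w 2 y * φ y) ≤ θ * (w 2 y * (z y + M * w b y)) := by
        have := w_pos 2 y
        gcongr
      have t4 : -(V y * φ y) ≤ θ * (w 2 y * z y) + (θ * M + A) * w (b + 2) y := by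
        have := hall y
        rw [← w_mul b 2] at this ⊢
        nlinarith
      calc _ ≤ Gk (x - y) * (θ * (w 2 y * z y) + (θ * M + A) * w (b + 2) y) := by gcongr
        _ = _ := by ring
    have up2 : (θ * M + A) * ∫ y, Gk (x - y) * w (b + 2) y ≤ kap d * (M * w b x) := by
      refine (mul_le_mul_of_nonneg_left j2 (by positivity)).trans (le_of_eq ?_)
      rw [← hDd, hθd, hM]; field_simp; ring
    rcases max_choice (φ x - M * w b x) 0 with hm | hm
    · simp only [hz, hm]; simp only [hz] at up; linarith
    · simp only [hz, hm]; simp only [hz] at nn; simpa using nn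
  intro x
  have : φ x - M * w b x ≤ z x := le_max_left _ _
  rw [key x] at this
  linarith
open Bornology

instance cob_cg : (cobounded (Ed d)).IsCountablyGenerated := by
  rw [← comap_norm_atTop]; infer_instance

lemma cob_norm {P : Ed d → Prop} : (∀ᶠ x in cobounded (Ed d), P x) ↔ ∃ r : ℝ, 0 < r ∧ ∀ x, r ≤ ‖x‖ → P x := by
  rw [← comap_norm_atTop, eventually_comap]
  constructor
  · intro h
    obtain ⟨r, hr⟩ := eventually_atTop.1 h
    exact ⟨max r 1, by positivity, fun x hx => hr _ ((le_max_left _ _).trans hx) x rfl⟩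
  · rintro ⟨r, -, hr⟩
    exact eventually_atTop.2 ⟨r, fun s hs x hx => hr x (hx ▸ hs)⟩

lemma norm_top : Tendsto (fun x : Ed d => ‖x‖) (cobounded (Ed d)) atTop := tendsto_norm_cobounded_atTop

lemma ratio (x y : Ed d) (_hx : 0 < ‖x‖) : ‖x‖ ^ ((d:ℝ) - 2) * Gk (x - y) = (‖x - y‖ / ‖x‖) ^ ((2:ℝ) - d) := by
  unfold Gk
  rw [Real.div_rpow (norm_nonneg _) (norm_nonneg _), show (d:ℝ) - 2 = -(2 - d) by ring, Real.rpow_neg (norm_nonneg _)]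
  rw [div_eq_mul_inv, mul_comm]

lemma ratio_lim (y : Ed d) : Tendsto (fun x : Ed d => ‖x‖ ^ ((d:ℝ) - 2) * Gk (x - y)) (cobounded (Ed d)) (𝓝 1) := by
  have h1 : Tendsto (fun x : Ed d => ‖x - y‖ / ‖x‖) (cobounded (Ed d)) (𝓝 1) := by
    have h0 : Tendsto (fun x : Ed d => ‖y‖ / ‖x‖) (cobounded (Ed d)) (𝓝 0) := norm_top.const_div_atTop _
    rw [tendsto_iff_norm_sub_tendsto_zero]
    refine squeeze_zero' (Eventually.of_forall fun x => norm_nonneg _) ?_ h0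
    filter_upwards [norm_top.eventually_gt_atTop 0] with x hx
    have : ‖x - y‖ / ‖x‖ - 1 = (‖x - y‖ - ‖x‖) / ‖x‖ := by field_simp
    rw [this, norm_div, norm_norm]
    gcongr
    have := abs_norm_sub_norm_le (x - y) x
    simpa using this
  have h2 := h1.rpow_const (p := (2:ℝ) - d) (Or.inl one_ne_zero)
  rw [Real.one_rpow] at h2
  refine h2.congr' ?_
  filter_upwards [norm_top.eventually_gt_atTop 0] with x hx
  rw [ratio x y hx]

lemma ratio_bd (hd : 5 ≤ d) {x y : Ed d} (hx : 0 < ‖x‖) (h : ‖x‖ / 2 ≤ ‖x - y‖) :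
    ‖x‖ ^ ((d:ℝ) - 2) * Gk (x - y) ≤ 2 ^ ((d:ℝ) - 2) := by
  have hd' : (5:ℝ) ≤ d := by exact_mod_cast hd
  rw [ratio x y hx]
  have e : (2:ℝ) ^ ((d:ℝ) - 2) = (1/2) ^ ((2:ℝ) - d) := by
    rw [one_div, Real.inv_rpow (by norm_num), ← Real.rpow_neg (by norm_num)]; congr 1; ring
  rw [e]
  refine Real.rpow_le_rpow_of_nonpos (by norm_num) ?_ (by linarith)
  rw [le_div_iff₀ hx]; linarith

lemma w_far (hd : 5 ≤ d) {x y : Ed d} (hx : 0 < ‖x‖) (h : ‖x‖ / 2 ≤ ‖y‖) :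
    ‖x‖ ^ ((d:ℝ) - 2) * w (d - 2) y ≤ 2 ^ ((d:ℝ) - 2) := by
  have hy : y ≠ 0 := by
    intro h0; rw [h0, norm_zero] at h; linarith
  have h1 := w_le_Gk hd hy
  have h2 := ratio_bd hd (x := x) (y := x - y) hx (by simpa using h)
  rw [sub_sub_cancel] at h2
  exact (mul_le_mul_of_nonneg_left h1 (by positivity)).trans h2

/-- Newtonian potential asymptotics, weighted version. -/
lemma asym (hd : 5 ≤ d) {F : Ed d → ℝ} (hF : Continuous F) {C : ℝ} (hC : 0 ≤ C)
    (hb : ∀ x, |F x| ≤ C * w (d + 1/2) x) :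
    Tendsto (fun x => ‖x‖ ^ ((d:ℝ) - 2) * ∫ y, Gk (x - y) * F y) (cobounded (Ed d)) (𝓝 (∫ y, F y)) := by
  have hd' : (5:ℝ) ≤ d := by exact_mod_cast hd
  have iw : Integrable (w (d + 1/2) : Ed d → ℝ) := w_int (by linarith)
  have iF : Integrable F := int_dom iw hF hb
  have iG : ∀ x, Integrable (fun y => Gk (x - y) * F y) := by
    refine Gk_int hd hF ?_
    refine int_dom (A := C) iw ((w_cont _).mul hF.abs) fun x => ?_
    have := w_pos (d - 2) x
    rw [abs_of_nonneg (by positivity)]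
    exact (mul_le_of_le_one_left (abs_nonneg _) (w_le_one (by linarith) x)).trans (hb x)
  let S : Ed d → Set (Ed d) := fun x => Metric.closedBall 0 (‖x‖ / 2)
  have mS : ∀ x, MeasurableSet (S x) := fun x => measurableSet_closedBall
  have iK : ∀ x, Integrable (fun y => ‖x‖ ^ ((d:ℝ) - 2) * (Gk (x - y) * F y)) := fun x => (iG x).const_mul _
  have e : ∀ x, ‖x‖ ^ ((d:ℝ) - 2) * ∫ y, Gk (x - y) * F y =
      (∫ y, (S x).indicator (fun y => ‖x‖ ^ ((d:ℝ) - 2) * (Gk (x - y) * F y)) y)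
      + ∫ y, (S x)ᶜ.indicator (fun y => ‖x‖ ^ ((d:ℝ) - 2) * (Gk (x - y) * F y)) y := fun x => by
    rw [integral_indicator (mS x), integral_indicator (mS x).compl, integral_add_compl (mS x) (iK x), integral_const_mul]
  simp only [e]
  rw [← add_zero (∫ y, F y)]
  refine Tendsto.add ?_ ?_
  · refine tendsto_integral_filter_of_dominated_convergence (fun y => 2 ^ ((d:ℝ) - 2) * |F y|) ?_ ?_ (iF.abs.const_mul _) ?_
    · exact Eventually.of_forall fun x => ((iK x).indicator (mS x)).aestronglyMeasurable
    · filter_upwards [norm_top.eventually_gt_atTop 0] with x hx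
      refine ae_of_all _ fun y => ?_
      by_cases hy : y ∈ S x
      · have hy' : ‖y‖ ≤ ‖x‖ / 2 := by simpa [S] using hy
        have : ‖x‖ / 2 ≤ ‖x - y‖ := by have := norm_sub_norm_le x y; linarith
        rw [Set.indicator_of_mem hy, ← mul_assoc, norm_mul, Real.norm_of_nonneg (mul_nonneg (by positivity) (Gk_nonneg _)), Real.norm_eq_abs]
        gcongr
        exact ratio_bd hd hx this
      · rw [Set.indicator_of_notMem hy, norm_zero]; positivity
    · refine ae_of_all _ fun y => ?_
      have := (ratio_lim y).mul_const (F y)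
      rw [one_mul] at this
      refine this.congr' ?_
      filter_upwards [norm_top.eventually_ge_atTop (2 * ‖y‖)] with x hx
      have hy : y ∈ S x := by simp [S]; linarith
      rw [Set.indicator_of_mem hy, mul_assoc]
  · have l0 : Tendsto (fun x : Ed d => C * 2 ^ ((d:ℝ) - 2) * (kap d / (1/2 * (d - 2 - 1/2)) * w (1/2) x)) (cobounded (Ed d)) (𝓝 0) := by
      simpa using ((w_tendsto (d := d) (b := 1/2) (by norm_num)).const_mul _).const_mul (C * 2 ^ ((d:ℝ) - 2))
    refine squeeze_zero_norm' ?_ l0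
    filter_upwards [norm_top.eventually_gt_atTop 0] with x hx
    obtain ⟨j1, j2⟩ := PB hd (b := 1/2) (by norm_num) (by linarith) x
    refine le_trans ?_ (mul_le_mul_of_nonneg_left j2 (by positivity))
    rw [← integral_const_mul]
    refine norm_integral_le_of_norm_le (j1.const_mul _) (ae_of_all _ fun y => ?_)
    have g := Gk_nonneg (x - y)
    have q := w_pos (1/2 + 2) y
    by_cases hy : y ∈ S x
    · rw [Set.indicator_of_notMem (by simpa using hy), norm_zero]; positivity
    · rw [Set.indicator_of_mem (by simpa using hy)]
      have hy' : ‖x‖ / 2 < ‖y‖ := by simpa [S] using hy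
      have a := w_far hd hx hy'.le
      have a2 := hb y
      rw [← w_mul' (show (d:ℝ) - 2 + (1/2 + 2) = d + 1/2 by ring)] at a2
      rw [norm_mul, norm_mul, Real.norm_of_nonneg (by positivity), Real.norm_of_nonneg g, Real.norm_eq_abs]
      calc _ ≤ ‖x‖ ^ ((d:ℝ) - 2) * (Gk (x - y) * (C * (w (d - 2) y * w (1/2 + 2) y))) := by gcongr
        _ = C * (‖x‖ ^ ((d:ℝ) - 2) * w (d - 2) y) * (Gk (x - y) * w (1/2 + 2) y) := by ring
        _ ≤ _ := by gcongr

lemma GS.Vφ {V φ : Ed d → ℝ} {β C₀ : ℝ} (hd : 5 ≤ d) (h : GS V φ β C₀) :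
    ∃ C : ℝ, 0 ≤ C ∧ ∀ x, |-(V x * φ x)| ≤ C * w (d + 1/2) x := by
  obtain ⟨M, hM, hb⟩ := h.decay1 hd
  have hC := h.hC
  refine ⟨C₀ * M, by positivity, fun x => ?_⟩
  have p := h.pos x
  have p3 := w_pos 3 x
  rw [abs_neg, abs_mul, abs_of_pos p, ← w_mul' (show 3 + ((d:ℝ) - 5/2) = d + 1/2 by ring)]
  have := h.V3 hd x
  calc _ ≤ (C₀ * w 3 x) * (M * w (d - 5/2) x) := by gcongr; exact hb x
    _ = _ := by ring

lemma GS.asym {V φ : Ed d → ℝ} {β C₀ : ℝ} (hd : 5 ≤ d) (h : GS V φ β C₀) :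
    Tendsto (fun x => ‖x‖ ^ ((d:ℝ) - 2) * φ x) (cobounded (Ed d)) (𝓝 ((kap d)⁻¹ * ∫ y, -(V y * φ y))) := by
  obtain ⟨C, hC, hb⟩ := h.Vφ hd
  have hk := kap_pos hd
  have := (_root_.asym hd (h.hV.mul h.hφ.continuous).neg hC hb).const_mul (kap d)⁻¹
  refine this.congr fun x => ?_
  have e := (h.repr hd).2 x
  show (kap d)⁻¹ * (‖x‖ ^ ((d:ℝ) - 2) * ∫ y, Gk (x - y) * -(V y * φ y)) = _
  rw [← e]; field_simp

lemma GS.decay {V φ : Ed d → ℝ} {β C₀ : ℝ} (hd : 5 ≤ d) (h : GS V φ β C₀) :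
    ∃ A : ℝ, 0 < A ∧ ∀ x, φ x ≤ A * w (d - 2) x := by
  have ev := (h.asym hd).eventually (gt_mem_nhds (lt_add_one _))
  set c := (kap d)⁻¹ * ∫ y, -(V y * φ y)
  obtain ⟨r, hr, hr'⟩ := cob_norm.1 ev
  obtain ⟨A, hA, hAb⟩ := bd_ball h.hφ.continuous (w_cont (d - 2)) (fun x => w_pos _ x) (max r 1)
  refine ⟨A + |c + 1| * 2 ^ ((d:ℝ)/2) + 1, by positivity, fun x => ?_⟩
  have p := w_pos (d - 2) x
  rw [add_mul, add_mul, one_mul]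
  rcases le_total ‖x‖ (max r 1) with hx | hx
  · have := hAb x hx
    have : 0 ≤ |c + 1| * 2 ^ ((d:ℝ)/2) * w (d - 2) x := by positivity
    linarith
  · have h1 : 1 ≤ ‖x‖ := (le_max_right _ _).trans hx
    have h2 := hr' x ((le_max_left _ _).trans hx)
    have h3 := Gk_le_w hd h1
    have e : Gk x * ‖x‖ ^ ((d:ℝ) - 2) = 1 := by
      unfold Gk; rw [← Real.rpow_add (by linarith)]; simp
    have : φ x ≤ |c + 1| * Gk x := by
      have g := Gk_nonneg x
      calc φ x = Gk x * (‖x‖ ^ ((d:ℝ) - 2) * φ x) := by rw [← mul_assoc, e, one_mul]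
        _ ≤ Gk x * |c + 1| := by gcongr; exact h2.le.trans (le_abs_self _)
        _ = _ := mul_comm _ _
    have : φ x ≤ |c + 1| * (2 ^ ((d:ℝ)/2) * w (d - 2) x) := this.trans (by gcongr)
    have : 0 ≤ A * w (d - 2) x := by positivity
    linarith

lemma mono_deriv {f : ℝ → ℝ} (hf : Monotone f) (x : ℝ) : 0 ≤ deriv f x := by
  exact Monotone.deriv_nonneg hf

lemma subsol (hd : 5 ≤ d) {C₀ : ℝ} (hC : 0 < C₀) : ∃ ρ : ℝ, 0 < ρ ∧ ∀ x : Ed d, ρ ≤ ‖x‖ →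
    Pw (d - 2) x + Pw (d - 3/2) x + C₀ * w 3 x * (w (d - 2) x + w (d - 3/2) x) ≤ 0 := by
  have hd' : (5:ℝ) ≤ d := by exact_mod_cast hd
  set K : ℝ := (d - 2) * d + (d - 3/2) * (d + 1/2) + 2 * C₀ with hK
  have h1 : (0:ℝ) < d - 2 := by linarith
  have h2 : (0:ℝ) < d - 3/2 := by linarith
  have hK0 : 0 < K := by positivity
  have ev := (w_tendsto (d := d) (b := 1/2) (by norm_num)).eventually
    (gt_mem_nhds (show (0:ℝ) < (d - 3/2) * (1/2) / K by positivity))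
  obtain ⟨ρ, hρ, hr⟩ := cob_norm.1 ev
  refine ⟨ρ, hρ, fun x hx => ?_⟩
  have a := hr x hx
  rw [lt_div_iff₀ hK0] at a
  have p := w_pos (d + 1/2) x
  have e1 : w (d + 1/2) x * w (1/2) x = w (d + 1) x := w_mul' (by ring) x
  have e2 : w 3 x * w (d - 2) x = w (d + 1) x := w_mul' (by ring) x
  have e3 : w 3 x * w (d - 3/2) x ≤ w (d + 1) x := by
    rw [w_mul]; exact w_anti (by linarith) x
  have e4 : w (d - 2 + 4) x ≤ w (d + 1) x := w_anti (by linarith) x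
  have e5 : w (d - 3/2 + 4) x ≤ w (d + 1) x := w_anti (by linarith) x
  have e6 : w (d - 3/2 + 2) x = w (d + 1/2) x := by congr 1; ring
  unfold Pw
  rw [e6]
  have t1 : ((d:ℝ) - 2) * (d - 2 + 2) * w (d - 2 + 4) x ≤ (d - 2) * d * w (d + 1) x := by
    rw [sub_add_cancel]; gcongr
  have t2 : ((d:ℝ) - 3/2) * (d - 3/2 + 2) * w (d - 3/2 + 4) x ≤ (d - 3/2) * (d + 1/2) * w (d + 1) x := by
    rw [show (d:ℝ) - 3/2 + 2 = d + 1/2 by ring]; gcongr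
  have t3 : C₀ * w 3 x * (w (d - 2) x + w (d - 3/2) x) ≤ 2 * C₀ * w (d + 1) x := by
    have : C₀ * (w 3 x * w (d - 2) x + w 3 x * w (d - 3/2) x) ≤ C₀ * (w (d + 1) x + w (d + 1) x) := by
      rw [e2]; gcongr
    linarith
  have t4 : K * w (d + 1) x ≤ (d - 3/2) * (1/2) * w (d + 1/2) x := by
    rw [← e1]; nlinarith
  rw [hK] at t4
  nlinarith

lemma max_princ (hd : 5 ≤ d) {z F : Ed d → ℝ} (hz : ContDiff ℝ 1 z) (hF : Continuous F) (hw : WE z F) {ε : ℝ}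
    (hs : ∃ r : ℝ, ∀ x, r ≤ ‖x‖ → z x ≤ ε) (h : ∀ x, ε < z x → F x ≤ 0) : ∀ x, z x ≤ ε := by
  let f : ℝ → ℝ := fun t => expNegInvGlue (t - ε)
  have hf : ContDiff ℝ 1 f := (expNegInvGlue.contDiff (n := 1)).comp (contDiff_id.sub contDiff_const)
  have fm : Monotone f := fun a b hab => expNegInvGlue.monotone (by linarith)
  have fd : ∀ t, HasDerivAt f (deriv f t) t := fun t => (hf.differentiable one_ne_zero t).hasDerivAt
  have fdc : Continuous (deriv f) := hf.continuous_deriv le_rfl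
  have hv : ContDiff ℝ 1 (fun x => f (z x)) := hf.comp hz
  obtain ⟨r, hr⟩ := hs
  have f0 : ∀ t, t ≤ ε → f t = 0 := fun t ht => expNegInvGlue.zero_of_nonpos (by linarith)
  have hc : HasCompactSupport (fun x => f (z x)) := by
    refine HasCompactSupport.intro (isCompact_closedBall (0 : Ed d) r) fun x hx => ?_
    have : r < ‖x‖ := by simpa using hx
    exact f0 _ (hr x this.le)
  have e := hw _ hv hc
  have eg : ∀ x, gradient (fun x => f (z x)) x = deriv f (z x) • gradient z x := fun x => grad_comp hz x (fd _)
  have le : ∫ x, F x * f (z x) ≤ 0 := by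
    refine integral_nonpos fun x => ?_
    show F x * f (z x) ≤ 0
    rcases le_or_gt (z x) ε with hx | hx
    · rw [f0 _ hx]; simp
    · exact mul_nonpos_of_nonpos_of_nonneg (h x hx) (expNegInvGlue.nonneg _)
  have nn : ∀ x, 0 ≤ inner ℝ (gradient z x) (gradient (fun x => f (z x)) x) := fun x => by
    rw [eg, inner_smul_right, real_inner_self_eq_norm_sq]
    exact mul_nonneg (mono_deriv fm _) (sq_nonneg _)
  have z0 : ∀ x, inner ℝ (gradient z x) (gradient (fun x => f (z x)) x) = 0 := by
    have i := inner_int hz hv hc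
    have c : Continuous fun x => inner ℝ (gradient z x) (gradient (fun x => f (z x)) x) :=
      (cont_grad hz).inner (cont_grad hv)
    have : ∫ x, inner ℝ (gradient z x) (gradient (fun x => f (z x)) x) = 0 :=
      le_antisymm (e ▸ le) (integral_nonneg nn)
    have := (integral_eq_zero_iff_of_nonneg nn i).1 this
    have := (Continuous.ae_eq_iff_eq volume c continuous_zero).1 this
    exact fun x => congrFun this x
  have g0 : ∀ x, fderiv ℝ (fun x => f (z x)) x = 0 := fun x => by
    have h1 := z0 x
    rw [eg, inner_smul_right, real_inner_self_eq_norm_sq] at h1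
    rw [← norm_eq_zero, ← norm_grad, eg, norm_smul]
    rcases mul_eq_zero.1 h1 with h2 | h2
    · simp [h2]
    · rw [pow_eq_zero_iff two_ne_zero] at h2; simp [h2]
  intro x
  by_contra hx
  push Not at hx
  have pos : 0 < f (z x) := expNegInvGlue.pos_of_pos (by linarith)
  have : Nonempty (Fin d) := ⟨⟨0, by omega⟩⟩
  obtain ⟨y, hy⟩ := NormedSpace.exists_lt_norm ℝ (Ed d) r
  have c := is_const_of_fderiv_eq_zero (hv.differentiable one_ne_zero) g0 x y
  rw [c, f0 _ (hr y hy.le)] at pos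
  exact lt_irrefl _ pos

lemma GS.lower {V φ : Ed d → ℝ} {β C₀ : ℝ} (hd : 5 ≤ d) (h : GS V φ β C₀) :
    ∃ M : ℝ, 0 < M ∧ ∀ x, w (d - 2) x ≤ M * φ x := by
  have hd' : (5:ℝ) ≤ d := by exact_mod_cast hd
  obtain ⟨ρ, hρ, hs⟩ := subsol hd h.hC
  have cφ := h.hφ.continuous
  set s : Ed d → ℝ := fun x => w (d - 2) x + w (d - 3/2) x with hsd
  have sc : ContDiff ℝ 1 s := (w_contDiff _).add (w_contDiff _)
  obtain ⟨M, hM, hMb⟩ := bd_ball sc.continuous cφ h.pos ρ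
  have st : Tendsto s (cobounded (Ed d)) (𝓝 0) := by
    simpa using (w_tendsto (d := d) (b := d - 2) (by linarith)).add (w_tendsto (d := d) (b := d - 3/2) (by linarith))
  have WEs : WE s (fun x => Pw (d - 2) x + Pw (d - 3/2) x) :=
    WE.add (w_contDiff _) (w_contDiff _) (Pw_cont _) (Pw_cont _) (WE_w _) (WE_w _)
  have WEz : WE (fun x => s x + -M * φ x) (fun x => (Pw (d - 2) x + Pw (d - 3/2) x) + -M * -(V x * φ x)) :=
    WE.add sc (contDiff_const.mul h.hφ) ((Pw_cont _).add (Pw_cont _))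
      (continuous_const.mul (h.hV.mul cφ).neg) WEs (WE.cmul _ h.hφ h.we)
  have key : ∀ ε : ℝ, 0 < ε → ∀ x, s x + -M * φ x ≤ ε := fun ε hε => by
    refine max_princ hd (sc.add (contDiff_const.mul h.hφ)) (((Pw_cont _).add (Pw_cont _)).add
      (continuous_const.mul (h.hV.mul cφ).neg)) WEz ?_ ?_
    · obtain ⟨r, -, hr⟩ := cob_norm.1 (st.eventually (gt_mem_nhds hε))
      refine ⟨r, fun x hx => ?_⟩
      have := hr x hx
      nlinarith [h.pos x]
    · intro x hx
      have hx' : M * φ x < s x := by linarith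
      have : ρ ≤ ‖x‖ := by
        by_contra hn
        have := hMb x (by linarith)
        linarith
      have a := hs x this
      have b := h.V3 hd x
      have p := h.pos x
      have : M * (V x * φ x) ≤ C₀ * w 3 x * s x := by
        calc M * (V x * φ x) = V x * (M * φ x) := by ring
          _ ≤ |V x| * (M * φ x) := by gcongr; exact le_abs_self _
          _ ≤ |V x| * s x := by gcongr
          _ ≤ _ := by
            have : 0 ≤ s x := (add_pos (w_pos _ _) (w_pos _ _)).le
            gcongr
      simp only [hsd] at this
      show (Pw (d - 2) x + Pw (d - 3/2) x) + -M * -(V x * φ x) ≤ 0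
      linarith
  refine ⟨M + 1, by positivity, fun x => ?_⟩
  have : s x + -M * φ x ≤ 0 := le_of_forall_pos_le_add fun ε hε => by simpa using key ε hε x
  have q := w_pos (d - 3/2) x
  have p := h.pos x
  simp only [hsd] at this
  linarith

lemma GS.c_pos {V φ : Ed d → ℝ} {β C₀ : ℝ} (hd : 5 ≤ d) (h : GS V φ β C₀) : ∫ x, V x * φ x < 0 := by
  obtain ⟨M, hM, hb⟩ := h.lower hd
  have hk := kap_pos hd
  have : Nonempty (Fin d) := ⟨⟨0, by omega⟩⟩
  have : (2:ℝ) ^ (-(d:ℝ)/2) / M ≤ (kap d)⁻¹ * ∫ y, -(V y * φ y) := by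
    refine ge_of_tendsto (h.asym hd) ?_
    filter_upwards [norm_top.eventually_ge_atTop 1] with x hx
    have h3 := Gk_le_w hd hx
    have e : ‖x‖ ^ ((d:ℝ) - 2) * Gk x = 1 := by
      unfold Gk; rw [← Real.rpow_add (by linarith)]; simp
    have e2 : (2:ℝ) ^ (-(d:ℝ)/2) * 2 ^ ((d:ℝ)/2) = 1 := by
      rw [← Real.rpow_add (by norm_num)]; ring_nf; simp
    rw [div_le_iff₀ hM]
    calc (2:ℝ) ^ (-(d:ℝ)/2) = 2 ^ (-(d:ℝ)/2) * (‖x‖ ^ ((d:ℝ) - 2) * Gk x) := by rw [e, mul_one]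
      _ ≤ 2 ^ (-(d:ℝ)/2) * (‖x‖ ^ ((d:ℝ) - 2) * (2 ^ ((d:ℝ)/2) * (M * φ x))) := by
        gcongr
        exact h3.trans (by gcongr; exact hb x)
      _ = (2 ^ (-(d:ℝ)/2) * 2 ^ ((d:ℝ)/2)) * (‖x‖ ^ ((d:ℝ) - 2) * φ x * M) := by ring
      _ = _ := by rw [e2, one_mul]
  have h1 : 0 < (kap d)⁻¹ * ∫ y, -(V y * φ y) := lt_of_lt_of_le (by positivity) this
  rw [integral_neg] at h1
  have := (mul_pos_iff_of_pos_left (inv_pos.2 hk)).1 h1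
  linarith

lemma pow_cancel {r : ℝ} (hr : 0 < r) : r ^ ((d:ℝ) - 2) * r ^ ((2:ℝ) - d) = 1 := by
  rw [← Real.rpow_add hr]; simp

lemma w_far2 (hd : 5 ≤ d) {x y : Ed d} (hx : 0 < ‖x‖) (h : ‖x‖ / 2 ≤ ‖y‖) :
    w (d - 2) y ≤ 2 ^ ((d:ℝ) - 2) * ‖x‖ ^ ((2:ℝ) - d) := by
  have := mul_le_mul_of_nonneg_right (w_far hd hx h) (Real.rpow_nonneg hx.le ((2:ℝ) - d))
  calc w (d - 2) y = (‖x‖ ^ ((d:ℝ) - 2) * ‖x‖ ^ ((2:ℝ) - d)) * w (d - 2) y := by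
        rw [pow_cancel hx, one_mul]
    _ = ‖x‖ ^ ((d:ℝ) - 2) * w (d - 2) y * ‖x‖ ^ ((2:ℝ) - d) := by ring
    _ ≤ _ := this

lemma GS.V2 {V φ : Ed d → ℝ} {β C₀ : ℝ} (h : GS V φ β C₀) (x : Ed d) : |V x| ≤ C₀ * w (d - 2) x :=
  (h.hVb x).trans (mul_le_mul_of_nonneg_left (w_anti h.hβ.le x) h.hC.le)

lemma cross {V₁ V₂ φ₁ φ₂ : Ed d → ℝ} {β C₀ : ℝ} (hd : 5 ≤ d) (h1 : GS V₁ φ₁ β C₀) (h2 : GS V₂ φ₂ β C₀) :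
    ∃ C : ℝ, 0 < C ∧ ∀ R : Ed d, 0 < ‖R‖ → ∀ x,
      |V₂ (x - R)| * φ₁ x ≤ C * ‖R‖ ^ ((2:ℝ) - d) * (φ₁ x + φ₂ (x - R)) := by
  obtain ⟨A, hA, hA'⟩ := h1.decay hd
  obtain ⟨M, hM, hM'⟩ := h2.lower hd
  have hC := h1.hC
  have h2p : (0:ℝ) < 2 ^ ((d:ℝ) - 2) := by positivity
  refine ⟨C₀ * 2 ^ ((d:ℝ) - 2) * (1 + A * M), by positivity, fun R hR x => ?_⟩
  set s := ‖R‖ ^ ((2:ℝ) - d) with hs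
  have hs0 : 0 < s := by positivity
  have p1 := h1.pos x
  have p2 := h2.pos (x - R)
  rcases lt_or_ge ‖x - R‖ (‖R‖ / 2) with hx | hx
  · have hx2 : ‖R‖ / 2 ≤ ‖x‖ := by
      have := norm_sub_norm_le R (R - x)
      rw [norm_sub_rev R x] at this
      simp at this; linarith
    have a1 : φ₁ x ≤ A * (2 ^ ((d:ℝ) - 2) * s) := (hA' x).trans (by gcongr; exact w_far2 hd hR hx2)
    have a2 : |V₂ (x - R)| ≤ C₀ * (M * φ₂ (x - R)) :=
      (h2.V2 _).trans (by gcongr; exact hM' _)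
    calc |V₂ (x - R)| * φ₁ x ≤ (C₀ * (M * φ₂ (x - R))) * (A * (2 ^ ((d:ℝ) - 2) * s)) := by gcongr
      _ = C₀ * 2 ^ ((d:ℝ) - 2) * (A * M) * s * φ₂ (x - R) := by ring
      _ ≤ _ := by gcongr <;> linarith
  · have a2 : |V₂ (x - R)| ≤ C₀ * (2 ^ ((d:ℝ) - 2) * s) :=
      (h2.V2 _).trans (by gcongr; exact w_far2 hd hR hx)
    calc |V₂ (x - R)| * φ₁ x ≤ (C₀ * (2 ^ ((d:ℝ) - 2) * s)) * φ₁ x := by gcongr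
      _ = C₀ * 2 ^ ((d:ℝ) - 2) * 1 * s * φ₁ x := by ring
      _ ≤ _ := by
        have : 0 < A * M := by positivity
        gcongr <;> linarith

lemma Q_id {V₁ V₂ φ₁ φ₂ : Ed d → ℝ} {β C₀ : ℝ} (h1 : GS V₁ φ₁ β C₀) (h2 : GS V₂ φ₂ β C₀) (R : Ed d)
    {ψ : Ed d → ℝ} (hψ : ContDiff ℝ 1 ψ) (hc : HasCompactSupport ψ) :
    Qf (fun x => V₁ x + V₂ (x - R)) (fun x => (φ₁ x + φ₂ (x - R)) * ψ x)
      = (∫ x, (φ₁ x + φ₂ (x - R)) ^ 2 * ‖gradient ψ x‖ ^ 2)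
        + ∫ x, (V₂ (x - R) * φ₁ x + V₁ x * φ₂ (x - R)) * ((φ₁ x + φ₂ (x - R)) * ψ x ^ 2) := by
  have c1 := h1.hV
  have c2 := h2.hV
  have f1 := h1.hφ
  have f2 := h2.hφ
  have f1c := h1.hφ.continuous
  have f2c := h2.hφ.continuous
  have ψc := hψ.continuous
  have hW : ContDiff ℝ 1 (fun x => φ₁ x + φ₂ (x - R)) := by fun_prop
  have hWE := WE.add h1.hφ (ψ := fun x => φ₂ (x - R)) (by fun_prop) (by fun_prop)
    (H := fun x => -(V₂ (x - R) * φ₂ (x - R))) (by fun_prop) h1.we (h2.we.shift R)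
  have hh : HasCompactSupport (fun x => ψ x ^ 2) := by
    have : HasCompactSupport (fun y => ψ y * ψ y) := hc.mul_left
    simpa [pow_two] using this
  have hcW : HasCompactSupport (fun x => (φ₁ x + φ₂ (x - R)) * ψ x) := hc.mul_left
  rw [Q_split (by fun_prop) (by fun_prop) hcW, gs_ident hW hWE hψ hc, add_assoc]
  congr 1
  rw [← integral_add]
  · congr 1; ext x; ring
  · exact int_mul (by fun_prop) (by fun_prop) hh.mul_left
  · refine (int_mul (F := fun x => (V₁ x + V₂ (x - R)) * (φ₁ x + φ₂ (x - R)) ^ 2) (by fun_prop) (by fun_prop) hh).congr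
      (Eventually.of_forall fun x => ?_)
    show _ * _ = _ * _
    ring

lemma E_lower {V₁ V₂ φ₁ φ₂ : Ed d → ℝ} {β C₀ : ℝ} (hd : 5 ≤ d) (h1 : GS V₁ φ₁ β C₀) (h2 : GS V₂ φ₂ β C₀) :
    ∃ C : ℝ, 0 < C ∧ ∀ R : Ed d, 0 < ‖R‖ → ∀ u, IsTest u →
      (-C * ‖R‖ ^ ((2:ℝ) - d)) * ∫ x, u x ^ 2 ≤ Qf (fun x => V₁ x + V₂ (x - R)) u := by
  obtain ⟨A, hA, hA'⟩ := cross hd h1 h2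
  obtain ⟨B, hB, hB'⟩ := cross hd h2 h1
  refine ⟨A + B, by positivity, fun R hR u hu => ?_⟩
  have c1 := h1.hV
  have c2 := h2.hV
  have f1 := h1.hφ
  have f2 := h2.hφ
  have f1c := h1.hφ.continuous
  have f2c := h2.hφ.continuous
  have hu1 := hu.c1
  set W : Ed d → ℝ := fun x => φ₁ x + φ₂ (x - R) with hW
  have Wp : ∀ x, 0 < W x := fun x => add_pos (h1.pos x) (h2.pos _)
  have Wd : ContDiff ℝ 1 W := by fun_prop
  have ψd : ContDiff ℝ 1 (fun x => (W x)⁻¹ * u x) := (Wd.inv fun x => (Wp x).ne').mul hu1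
  have ψs : HasCompactSupport (fun x => (W x)⁻¹ * u x) := hu.2.mul_left
  have key := Q_id h1 h2 R ψd ψs
  have e : (fun x => (φ₁ x + φ₂ (x - R)) * ((W x)⁻¹ * u x)) = u := by
    ext x
    show W x * ((W x)⁻¹ * u x) = u x
    rw [← mul_assoc, mul_inv_cancel₀ (Wp x).ne', one_mul]
  rw [e] at key
  rw [key]
  have n1 : 0 ≤ ∫ x, (φ₁ x + φ₂ (x - R)) ^ 2 * ‖gradient (fun x => (W x)⁻¹ * u x) x‖ ^ 2 :=
    integral_nonneg fun x => by positivity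
  refine le_trans ?_ (le_add_of_nonneg_left n1)
  rw [← integral_const_mul]
  have hh : HasCompactSupport (fun x => u x ^ 2) := by
    have : HasCompactSupport (fun y => u y * u y) := hu.2.mul_left
    simpa [pow_two] using this
  have hh2 : HasCompactSupport (fun x => ((W x)⁻¹ * u x) ^ 2) := by
    have : HasCompactSupport (fun y => ((W y)⁻¹ * u y) * ((W y)⁻¹ * u y)) := ψs.mul_left
    simpa [pow_two] using this
  have uc := hu1.continuous
  have ψc := ψd.continuous
  refine integral_mono (int_of (by fun_prop) hh.mul_left)
    (int_mul (by fun_prop) (by fun_prop) hh2.mul_left) fun x => ?_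
  show -(A + B) * ‖R‖ ^ ((2:ℝ) - d) * u x ^ 2 ≤ (V₂ (x - R) * φ₁ x + V₁ x * φ₂ (x - R)) * (W x * ((W x)⁻¹ * u x) ^ 2)
  have q1 := hA' R hR x
  have q2 := hB' (-R) (by simpa using hR) (x - R)
  simp only [norm_neg, sub_neg_eq_add, sub_add_cancel] at q2
  have k1 : -(|V₂ (x - R)| * φ₁ x) ≤ V₂ (x - R) * φ₁ x := by
    have := mul_le_mul_of_nonneg_right (neg_abs_le (V₂ (x - R))) (h1.pos x).le
    linarith
  have k2 : -(|V₁ x| * φ₂ (x - R)) ≤ V₁ x * φ₂ (x - R) := by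
    have := mul_le_mul_of_nonneg_right (neg_abs_le (V₁ x)) (h2.pos (x - R)).le
    linarith
  have k3 : -(A + B) * ‖R‖ ^ ((2:ℝ) - d) * W x ≤ V₂ (x - R) * φ₁ x + V₁ x * φ₂ (x - R) := by
    simp only [hW]; linarith
  have hw := (Wp x).ne'
  have e1 : -(A + B) * ‖R‖ ^ ((2:ℝ) - d) * u x ^ 2
      = (-(A + B) * ‖R‖ ^ ((2:ℝ) - d) * W x) * (W x * ((W x)⁻¹ * u x) ^ 2) := by
    field_simp
  rw [e1]
  have := Wp x
  gcongr

lemma sub_cob (y : Ed d) : Tendsto (fun R : Ed d => y - R) (cobounded (Ed d)) (cobounded (Ed d)) := by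
  rw [← tendsto_norm_atTop_iff_cobounded]
  refine tendsto_atTop_mono (fun R => ?_) (tendsto_atTop_add_const_right _ (-‖y‖) norm_top)
  have := norm_sub_norm_le R y
  rw [norm_sub_rev y R]; linarith

lemma neg_cob : Tendsto (fun R : Ed d => -R) (cobounded (Ed d)) (cobounded (Ed d)) := by
  simpa using sub_cob (0 : Ed d)

lemma shift_lim {H : Ed d → ℝ} {c : ℝ} (hl : Tendsto (fun x => ‖x‖ ^ ((d:ℝ) - 2) * H x) (cobounded (Ed d)) (𝓝 c)) (y : Ed d) :
    Tendsto (fun R : Ed d => ‖R‖ ^ ((d:ℝ) - 2) * H (y - R)) (cobounded (Ed d)) (𝓝 c) := by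
  have := (ratio_lim y).mul (hl.comp (sub_cob y))
  rw [one_mul] at this
  refine this.congr' ?_
  filter_upwards [(norm_top.comp (sub_cob y)).eventually_gt_atTop 0] with R hR
  have hR' : 0 < ‖y - R‖ := hR
  have e := pow_cancel (d := d) hR'
  simp only [Function.comp]
  rw [Gk_symm]
  unfold Gk
  calc _ = ‖R‖ ^ ((d:ℝ) - 2) * (‖y - R‖ ^ ((d:ℝ) - 2) * ‖y - R‖ ^ ((2:ℝ) - d)) * H (y - R) := by ring
    _ = _ := by rw [e, mul_one]

lemma far_or {R x : Ed d} : ‖R‖ / 2 ≤ ‖x‖ ∨ ‖R‖ / 2 ≤ ‖x - R‖ := by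
  by_contra! h
  have := norm_sub_norm_le R (R - x)
  rw [norm_sub_rev R x] at this
  simp at this; linarith

lemma w_conv (hd : 5 ≤ d) (R : Ed d) : Integrable (fun y => Gk (R - y) * w (5/2) y) ∧
    ∫ y, Gk (R - y) * w (5/2) y ≤ kap d / (1/2 * (d - 2 - 1/2)) * w (1/2) R := by
  have hd' : (5:ℝ) ≤ d := by exact_mod_cast hd
  have := PB hd (b := 1/2) (by norm_num) (by linarith) R
  have e : (1/2 + 2 : ℝ) = 5/2 := by norm_num
  rwa [e] at this

lemma w_le_Gk2 (hd : 5 ≤ d) {x R : Ed d} (hx : x ≠ R) : w (d - 2) (x - R) ≤ Gk (R - x) := by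
  rw [Gk_symm]
  exact w_le_Gk hd (sub_ne_zero.2 hx)

lemma ne_ae (hd : 5 ≤ d) (R : Ed d) : ∀ᵐ x : Ed d, x ≠ R := by
  have : Nonempty (Fin d) := ⟨⟨0, by omega⟩⟩
  have : Nontrivial (Ed d) := by infer_instance
  rw [ae_iff]; simp

lemma asym2 (hd : 5 ≤ d) {F H : Ed d → ℝ} (hF : Continuous F) (hH : Continuous H) {C A c : ℝ} (hC : 0 ≤ C) (hA : 0 ≤ A)
    (hb : ∀ x, |F x| ≤ C * w (d + 1/2) x) (hh : ∀ x, |H x| ≤ A * w (d - 2) x)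
    (hl : Tendsto (fun x => ‖x‖ ^ ((d:ℝ) - 2) * H x) (cobounded (Ed d)) (𝓝 c)) :
    Tendsto (fun R => ‖R‖ ^ ((d:ℝ) - 2) * ∫ y, H (y - R) * F y) (cobounded (Ed d)) (𝓝 (c * ∫ y, F y)) := by
  have hd' : (5:ℝ) ≤ d := by exact_mod_cast hd
  have iw : Integrable (w (d + 1/2) : Ed d → ℝ) := w_int (by linarith)
  have iF : Integrable F := int_dom iw hF hb
  have iG : ∀ R, Integrable (fun y => H (y - R) * F y) := fun R => by
    refine int_dom (A := A) iF.abs (by fun_prop) fun x => ?_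
    rw [abs_mul]
    gcongr
    exact (hh _).trans (mul_le_of_le_one_right hA (w_le_one (by linarith) _))
  let S : Ed d → Set (Ed d) := fun R => Metric.closedBall 0 (‖R‖ / 2)
  have mS : ∀ x, MeasurableSet (S x) := fun x => measurableSet_closedBall
  have iK : ∀ x, Integrable (fun y => ‖x‖ ^ ((d:ℝ) - 2) * (H (y - x) * F y)) := fun x => (iG x).const_mul _
  have e : ∀ x, ‖x‖ ^ ((d:ℝ) - 2) * ∫ y, H (y - x) * F y =
      (∫ y, (S x).indicator (fun y => ‖x‖ ^ ((d:ℝ) - 2) * (H (y - x) * F y)) y)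
      + ∫ y, (S x)ᶜ.indicator (fun y => ‖x‖ ^ ((d:ℝ) - 2) * (H (y - x) * F y)) y := fun x => by
    rw [integral_indicator (mS x), integral_indicator (mS x).compl, integral_add_compl (mS x) (iK x), integral_const_mul]
  simp only [e]
  rw [← add_zero (c * ∫ y, F y), ← integral_const_mul]
  refine Tendsto.add ?_ ?_
  · refine tendsto_integral_filter_of_dominated_convergence (fun y => A * 2 ^ ((d:ℝ) - 2) * |F y|) ?_ ?_ (iF.abs.const_mul _) ?_
    · exact Eventually.of_forall fun x => ((iK x).indicator (mS x)).aestronglyMeasurable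
    · filter_upwards [norm_top.eventually_gt_atTop 0] with x hx
      refine ae_of_all _ fun y => ?_
      by_cases hy : y ∈ S x
      · have hy' : ‖y‖ ≤ ‖x‖ / 2 := by simpa [S] using hy
        have h2 : ‖x‖ / 2 ≤ ‖y - x‖ := by
          have := norm_sub_norm_le x y
          rw [norm_sub_rev] at this; linarith
        rw [Set.indicator_of_mem hy, ← mul_assoc, norm_mul, norm_mul, Real.norm_of_nonneg (by positivity), Real.norm_eq_abs, Real.norm_eq_abs]
        refine mul_le_mul_of_nonneg_right ?_ (abs_nonneg _)
        calc _ ≤ ‖x‖ ^ ((d:ℝ) - 2) * (A * w (d - 2) (y - x)) := by gcongr; exact hh _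
          _ = A * (‖x‖ ^ ((d:ℝ) - 2) * w (d - 2) (y - x)) := by ring
          _ ≤ _ := by gcongr; exact w_far hd hx h2
      · rw [Set.indicator_of_notMem hy, norm_zero]; positivity
    · refine ae_of_all _ fun y => ?_
      refine ((shift_lim hl y).mul_const (F y)).congr' ?_
      filter_upwards [norm_top.eventually_ge_atTop (2 * ‖y‖)] with x hx
      have hy : y ∈ S x := by simp [S]; linarith
      rw [Set.indicator_of_mem hy, mul_assoc]
  · have l0 : Tendsto (fun x : Ed d => A * C * 2 ^ ((d:ℝ) - 2) * (kap d / (1/2 * (d - 2 - 1/2)) * w (1/2) x)) (cobounded (Ed d)) (𝓝 0) := by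
      simpa using ((w_tendsto (d := d) (b := 1/2) (by norm_num)).const_mul _).const_mul (A * C * 2 ^ ((d:ℝ) - 2))
    refine squeeze_zero_norm' ?_ l0
    filter_upwards [norm_top.eventually_gt_atTop 0] with x hx
    obtain ⟨j1, j2⟩ := w_conv hd x
    refine le_trans ?_ (mul_le_mul_of_nonneg_left j2 (by positivity))
    rw [← integral_const_mul]
    refine norm_integral_le_of_norm_le (j1.const_mul _) ?_
    filter_upwards [ne_ae hd x] with y hyx
    have g := Gk_nonneg (x - y)
    have q := w_pos (5/2) y
    by_cases hy : y ∈ S x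
    · rw [Set.indicator_of_notMem (by simpa using hy), norm_zero]; positivity
    · rw [Set.indicator_of_mem (by simpa using hy)]
      have hy' : ‖x‖ / 2 < ‖y‖ := by simpa [S] using hy
      have a := w_far hd hx hy'.le
      have a2 := hb y
      have a3 := (hh (y - x)).trans (mul_le_mul_of_nonneg_left (w_le_Gk2 hd hyx) hA)
      rw [← w_mul' (show (d:ℝ) - 2 + 5/2 = d + 1/2 by ring)] at a2
      rw [norm_mul, norm_mul, Real.norm_of_nonneg (by positivity), Real.norm_eq_abs, Real.norm_eq_abs]
      calc _ ≤ ‖x‖ ^ ((d:ℝ) - 2) * ((A * Gk (x - y)) * (C * (w (d - 2) y * w (5/2) y))) := by gcongr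
        _ = A * C * (‖x‖ ^ ((d:ℝ) - 2) * w (d - 2) y) * (Gk (x - y) * w (5/2) y) := by ring
        _ ≤ _ := by gcongr

lemma small (hd : 5 ≤ d) {β : ℝ} (hβ : (d:ℝ) - 2 < β) :
    Tendsto (fun R : Ed d => ‖R‖ ^ ((d:ℝ) - 2) * ∫ x, w β x * w (d - 2) (x - R) ^ 2) (cobounded (Ed d)) (𝓝 0) := by
  have hd' : (5:ℝ) ≤ d := by exact_mod_cast hd
  have iw : Integrable (w (2 * d - 4) : Ed d → ℝ) := w_int (by linarith)
  have iwR : ∀ R : Ed d, Integrable (fun x => w (2 * d - 4) (x - R)) := fun R => iw.comp_sub_right R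
  have e2 : ∀ z : Ed d, w (d - 2) z ^ 2 = w (2 * d - 4) z := fun z => by
    rw [pow_two, w_mul' (show (d:ℝ) - 2 + (d - 2) = 2 * d - 4 by ring)]
  have hδ : 0 < β - (d - 2) := by linarith
  have cw : ∀ b, Continuous (w b : Ed d → ℝ) := fun b => w_cont b
  have i1 : ∀ R : Ed d, Integrable (fun x => w (β - (d - 2)) x * w (2 * d - 4) (x - R)) := fun R => by
    refine int_dom (A := 1) (iwR R) ?_ fun x => ?_
    · have := cw (β - (d - 2)); have := cw (2 * d - 4); fun_prop
    · have := w_pos (β - (d - 2)) x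
      have := w_pos (2 * d - 4) (x - R)
      rw [abs_of_nonneg (by positivity)]
      gcongr
      exact w_le_one hδ.le x
  have t1 : Tendsto (fun R : Ed d => ∫ x, w (β - (d - 2)) x * w (2 * d - 4) (x - R)) (cobounded (Ed d)) (𝓝 0) := by
    have e : ∀ R : Ed d, ∫ x, w (β - (d - 2)) x * w (2 * d - 4) (x - R) = ∫ x, w (β - (d - 2)) (x - (-R)) * w (2 * d - 4) x := fun R => by
      rw [← integral_add_right_eq_self _ R]
      simp
    simp only [e]
    have z : (0:ℝ) = ∫ x : Ed d, (0:ℝ) := by simp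
    rw [z]
    refine tendsto_integral_filter_of_dominated_convergence (w (2 * d - 4)) ?_ ?_ iw ?_
    · refine Eventually.of_forall fun R => Continuous.aestronglyMeasurable ?_
      have := cw (β - (d - 2)); have := cw (2 * d - 4); fun_prop
    · refine Eventually.of_forall fun R => ae_of_all _ fun x => ?_
      have := w_pos (β - (d - 2)) (x - -R)
      have := w_pos (2 * d - 4) x
      rw [Real.norm_of_nonneg (by positivity)]
      exact mul_le_of_le_one_left (by positivity) (w_le_one hδ.le _)
    · refine ae_of_all _ fun x => ?_
      have := ((w_tendsto (d := d) hδ).comp ((sub_cob x).comp neg_cob)).mul_const (w (2 * d - 4) x)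
      simpa using this
  have t2 : Tendsto (fun x : Ed d => (kap d / (1/2 * (d - 2 - 1/2)) * w (1/2) x)) (cobounded (Ed d)) (𝓝 0) := by
    simpa using ((w_tendsto (d := d) (b := 1/2) (by norm_num)).const_mul (kap d / (1/2 * (d - 2 - 1/2))))
  have t3 := (t1.add t2).const_mul ((2:ℝ) ^ ((d:ℝ) - 2))
  rw [add_zero, mul_zero] at t3
  refine squeeze_zero_norm' ?_ t3
  filter_upwards [norm_top.eventually_gt_atTop 0] with R hR
  obtain ⟨j1, j2⟩ := w_conv hd R
  refine le_trans ?_ (mul_le_mul_of_nonneg_left (add_le_add_right j2 _) (by positivity))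
  rw [← integral_add (i1 R) j1, ← integral_const_mul, ← integral_const_mul]
  have i2 : Integrable (fun x => w (β - (d - 2)) x * w (2 * d - 4) (x - R) + Gk (R - x) * w (5/2) x) := (i1 R).add j1
  refine norm_integral_le_of_norm_le (i2.const_mul _) ?_
  filter_upwards [ne_ae hd R] with x hx
  have p1 := w_pos β x
  have p2 := w_pos (d - 2) (x - R)
  have p3 := w_pos (β - (d - 2)) x
  have p4 := w_pos (5/2) x
  have g := Gk_nonneg (R - x)
  rw [Real.norm_of_nonneg (by positivity)]
  rcases far_or (R := R) (x := x) with h | h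
  · have a := w_far hd hR h
    rw [← w_mul' (show (d:ℝ) - 2 + (β - (d - 2)) = β by ring), ← e2]
    calc _ = (‖R‖ ^ ((d:ℝ) - 2) * w (d - 2) x) * (w (β - (d - 2)) x * w (d - 2) (x - R) ^ 2) := by ring
      _ ≤ 2 ^ ((d:ℝ) - 2) * (w (β - (d - 2)) x * w (d - 2) (x - R) ^ 2 + 0) := by rw [add_zero]; gcongr
      _ ≤ _ := by gcongr; positivity
  · have a := w_far hd hR h
    have b := w_anti (show (5/2:ℝ) ≤ β by linarith) x
    have c := w_le_Gk2 hd hx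
    have p5 := w_pos (2 * d - 4) (x - R)
    calc _ = (‖R‖ ^ ((d:ℝ) - 2) * w (d - 2) (x - R)) * (w (d - 2) (x - R) * w β x) := by ring
      _ ≤ 2 ^ ((d:ℝ) - 2) * (0 + Gk (R - x) * w (5/2) x) := by rw [zero_add]; gcongr
      _ ≤ _ := by gcongr; positivity

lemma GS.sq_int {V φ : Ed d → ℝ} {β C₀ : ℝ} (hd : 5 ≤ d) (h : GS V φ β C₀) : Integrable (fun x => φ x ^ 2) := by
  have hd' : (5:ℝ) ≤ d := by exact_mod_cast hd
  obtain ⟨A, hA, hA'⟩ := h.decay hd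
  have iw : Integrable (w (2 * d - 4) : Ed d → ℝ) := w_int (by linarith)
  refine int_dom (A := A ^ 2) iw (h.hφ.continuous.pow 2) fun x => ?_
  rw [abs_of_nonneg (sq_nonneg _), ← w_mul' (show (d:ℝ) - 2 + (d - 2) = 2 * d - 4 by ring), ← pow_two, ← mul_pow]
  have := h.pos x
  gcongr
  exact hA' x

lemma GS.Vbd {V φ : Ed d → ℝ} {β C₀ : ℝ} (hd : 5 ≤ d) (h : GS V φ β C₀) (x : Ed d) : |V x| ≤ C₀ := by
  have hd' : (5:ℝ) ≤ d := by exact_mod_cast hd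
  exact (h.V2 x).trans (mul_le_of_le_one_right h.hC.le (w_le_one (by linarith) x))

lemma half_int {V₁ V₂ φ₁ φ₂ : Ed d → ℝ} {β C₀ : ℝ} (hd : 5 ≤ d) (h1 : GS V₁ φ₁ β C₀) (h2 : GS V₂ φ₂ β C₀) (R : Ed d) :
    Integrable (fun x => φ₂ (x - R) * (V₁ x * φ₁ x)) ∧ Integrable (fun x => V₁ x * φ₂ (x - R) ^ 2) := by
  have c1 := h1.hV
  have f1c := h1.hφ.continuous
  have f2c := h2.hφ.continuous
  have s1 := h1.sq_int hd
  have s2 : Integrable (fun x => φ₂ (x - R) ^ 2) := (h2.sq_int hd).comp_sub_right R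
  have s3 : Integrable (fun x => φ₁ x ^ 2 + φ₂ (x - R) ^ 2) := s1.add s2
  have hC := h1.hC
  constructor
  · refine int_dom (A := C₀) s3 (by fun_prop) fun x => ?_
    have p1 := h1.pos x
    have p2 := h2.pos (x - R)
    rw [abs_mul, abs_mul, abs_of_pos p1, abs_of_pos p2]
    calc _ = |V₁ x| * (φ₁ x * φ₂ (x - R)) := by ring
      _ ≤ C₀ * (φ₁ x * φ₂ (x - R)) := by gcongr; exact h1.Vbd hd x
      _ ≤ _ := by gcongr; nlinarith [sq_nonneg (φ₁ x - φ₂ (x - R))]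
  · refine int_dom (A := C₀) s2 (by fun_prop) fun x => ?_
    rw [abs_mul, abs_of_nonneg (sq_nonneg (φ₂ (x - R)))]
    gcongr; exact h1.Vbd hd x

lemma half {V₁ V₂ φ₁ φ₂ : Ed d → ℝ} {β C₀ : ℝ} (hd : 5 ≤ d) (h1 : GS V₁ φ₁ β C₀) (h2 : GS V₂ φ₂ β C₀) :
    ∃ m : ℝ, m < 0 ∧ Tendsto (fun R : Ed d => ‖R‖ ^ ((d:ℝ) - 2) * ∫ x, V₁ x * φ₂ (x - R) * (φ₁ x + φ₂ (x - R)))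
      (cobounded (Ed d)) (𝓝 m) := by
  have hd' : (5:ℝ) ≤ d := by exact_mod_cast hd
  obtain ⟨A, hA, hA'⟩ := h2.decay hd
  obtain ⟨C, hC, hC'⟩ := h1.Vφ hd
  have as := h2.asym hd
  have c1 := h1.hV
  have f1c := h1.hφ.continuous
  have f2c := h2.hφ.continuous
  set c := (kap d)⁻¹ * ∫ y, -(V₂ y * φ₂ y) with hc
  have cpos : 0 < c := by
    have := h2.c_pos hd
    have k := kap_pos hd
    rw [hc, integral_neg]
    have : 0 < -∫ y, V₂ y * φ₂ y := by linarith
    positivity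
  have t1 := asym2 hd (F := fun x => V₁ x * φ₁ x) (H := φ₂) (by fun_prop) f2c hC hA.le
    (fun x => by have := hC' x; rwa [abs_neg] at this) (fun x => by rw [abs_of_pos (h2.pos x)]; exact hA' x) as
  refine ⟨c * ∫ x, V₁ x * φ₁ x, mul_neg_of_pos_of_neg cpos (h1.c_pos hd), ?_⟩
  have t2 : Tendsto (fun R : Ed d => ‖R‖ ^ ((d:ℝ) - 2) * ∫ x, V₁ x * φ₂ (x - R) ^ 2) (cobounded (Ed d)) (𝓝 0) := by
    have t := (small hd h1.hβ).const_mul (C₀ * A ^ 2)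
    rw [mul_zero] at t
    refine squeeze_zero_norm (fun R => ?_) t
    have hC0 := h1.hC
    rw [norm_mul, Real.norm_of_nonneg (by positivity)]
    have iw : Integrable (w (2 * d - 4) : Ed d → ℝ) := w_int (by linarith)
    have i3 : Integrable (fun x => w β x * w (d - 2) (x - R) ^ 2) := by
      have iwR : Integrable (fun x => w (2 * d - 4) (x - R)) := iw.comp_sub_right R
      refine int_dom (A := 1) iwR ?_ fun x => ?_
      · have := w_cont (d := d) β; have := w_cont (d := d) (d - 2); fun_prop
      · have p1 := w_pos β x
        have p2 := w_pos (d - 2) (x - R)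
        rw [abs_of_nonneg (by positivity), ← w_mul' (show (d:ℝ) - 2 + (d - 2) = 2 * d - 4 by ring), ← pow_two]
        gcongr
        exact w_le_one (by linarith [h1.hβ]) x
    have : ‖∫ x, V₁ x * φ₂ (x - R) ^ 2‖ ≤ ∫ x, C₀ * A ^ 2 * (w β x * w (d - 2) (x - R) ^ 2) := by
      refine norm_integral_le_of_norm_le (i3.const_mul _) (ae_of_all _ fun x => ?_)
      have p1 := w_pos β x
      have p2 := h2.pos (x - R)
      rw [norm_mul, Real.norm_eq_abs, Real.norm_of_nonneg (sq_nonneg _)]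
      calc _ ≤ (C₀ * w β x) * (A * w (d - 2) (x - R)) ^ 2 := by
            gcongr
            · exact h1.hVb x
            · exact hA' _
        _ = _ := by ring
    rw [integral_const_mul] at this
    calc _ ≤ ‖R‖ ^ ((d:ℝ) - 2) * (C₀ * A ^ 2 * ∫ x, w β x * w (d - 2) (x - R) ^ 2) := by gcongr
      _ = _ := by ring
  have t3 := t1.add t2
  rw [add_zero] at t3
  refine t3.congr fun R => ?_
  obtain ⟨i1, i2⟩ := half_int hd h1 h2 R
  rw [← mul_add, ← integral_add i1 i2]
  congr 2
  ext x; ring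

lemma NW_lim {V₁ V₂ φ₁ φ₂ : Ed d → ℝ} {β C₀ : ℝ} (hd : 5 ≤ d) (h1 : GS V₁ φ₁ β C₀) (h2 : GS V₂ φ₂ β C₀) :
    ∃ m : ℝ, 0 < m ∧ ∃ r : ℝ, 0 < r ∧ ∀ R : Ed d, r ≤ ‖R‖ →
      ∫ x, (V₂ (x - R) * φ₁ x + V₁ x * φ₂ (x - R)) * (φ₁ x + φ₂ (x - R)) ≤ -m * ‖R‖ ^ ((2:ℝ) - d) := by
  obtain ⟨a, ha, ta⟩ := half hd h1 h2
  obtain ⟨b, hb, tb⟩ := half hd h2 h1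
  have t := ta.add (tb.comp neg_cob)
  have ev := t.eventually (gt_mem_nhds (show a + b < (a + b) / 2 by linarith))
  obtain ⟨r, hr, h⟩ := cob_norm.1 ev
  refine ⟨-((a + b) / 2), by linarith, r, hr, fun R hR => ?_⟩
  have hR0 : 0 < ‖R‖ := by linarith
  have q := h R hR
  simp only [Function.comp, norm_neg, sub_neg_eq_add] at q
  rw [← mul_add] at q
  have e : ∫ x, V₂ x * φ₁ (x + R) * (φ₂ x + φ₁ (x + R)) = ∫ x, V₂ (x - R) * φ₁ x * (φ₂ (x - R) + φ₁ x) := by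
    rw [← integral_sub_right_eq_self _ R]; simp
  have j1 : Integrable (fun x => V₁ x * φ₂ (x - R) * (φ₁ x + φ₂ (x - R))) := by
    obtain ⟨i1, i2⟩ := half_int hd h1 h2 R
    refine (i1.add i2).congr (ae_of_all _ fun x => ?_)
    simp only [Pi.add_apply]; ring
  have j2 : Integrable (fun x => V₂ (x - R) * φ₁ x * (φ₂ (x - R) + φ₁ x)) := by
    obtain ⟨i1, i2⟩ := half_int hd h2 h1 (-R)
    refine ((i1.add i2).comp_sub_right R).congr (ae_of_all _ fun x => ?_)
    simp only [Pi.add_apply, sub_neg_eq_add, sub_add_cancel]; ring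
  rw [e, ← integral_add j1 j2] at q
  have e2 : ∫ x, (V₂ (x - R) * φ₁ x + V₁ x * φ₂ (x - R)) * (φ₁ x + φ₂ (x - R))
      = ∫ x, (V₁ x * φ₂ (x - R) * (φ₁ x + φ₂ (x - R)) + V₂ (x - R) * φ₁ x * (φ₂ (x - R) + φ₁ x)) := by
    congr 1; ext x; ring
  rw [e2]
  set I := ∫ x, (V₁ x * φ₂ (x - R) * (φ₁ x + φ₂ (x - R)) + V₂ (x - R) * φ₁ x * (φ₂ (x - R) + φ₁ x))
  have p : 0 < ‖R‖ ^ ((2:ℝ) - d) := by positivity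
  have := mul_le_mul_of_nonneg_right q.le p.le
  calc I = (‖R‖ ^ ((d:ℝ) - 2) * ‖R‖ ^ ((2:ℝ) - d)) * I := by rw [pow_cancel hR0, one_mul]
    _ = ‖R‖ ^ ((d:ℝ) - 2) * I * ‖R‖ ^ ((2:ℝ) - d) := by ring
    _ ≤ _ := this
    _ = _ := by ring

lemma W_int {V₁ V₂ φ₁ φ₂ : Ed d → ℝ} {β C₀ : ℝ} (hd : 5 ≤ d) (h1 : GS V₁ φ₁ β C₀) (h2 : GS V₂ φ₂ β C₀) (R : Ed d) :
    Integrable (fun x => (φ₁ x + φ₂ (x - R)) ^ 2) ∧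
    ∫ x, (φ₁ x + φ₂ (x - R)) ^ 2 ≤ 2 * (∫ x, φ₁ x ^ 2) + 2 * ∫ x, φ₂ x ^ 2 := by
  have f1c := h1.hφ.continuous
  have f2c := h2.hφ.continuous
  have s1 := h1.sq_int hd
  have s2 : Integrable (fun x => φ₂ (x - R) ^ 2) := (h2.sq_int hd).comp_sub_right R
  have s3 : Integrable (fun x => 2 * φ₁ x ^ 2 + 2 * φ₂ (x - R) ^ 2) := (s1.const_mul 2).add (s2.const_mul 2)
  have b : ∀ x, (φ₁ x + φ₂ (x - R)) ^ 2 ≤ 2 * φ₁ x ^ 2 + 2 * φ₂ (x - R) ^ 2 := fun x => by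
    nlinarith [sq_nonneg (φ₁ x - φ₂ (x - R))]
  have i : Integrable (fun x => (φ₁ x + φ₂ (x - R)) ^ 2) :=
    int_dom (A := 1) s3 (by fun_prop) fun x => by rw [abs_of_nonneg (sq_nonneg _), one_mul]; exact b x
  refine ⟨i, (integral_mono i s3 b).trans (le_of_eq ?_)⟩
  rw [integral_add (s1.const_mul 2) (s2.const_mul 2), integral_const_mul, integral_const_mul,
    integral_sub_right_eq_self (fun x => φ₂ x ^ 2) R]

lemma E_test {V₁ V₂ φ₁ φ₂ : Ed d → ℝ} {β C₀ : ℝ} (hd : 5 ≤ d) (h1 : GS V₁ φ₁ β C₀) (h2 : GS V₂ φ₂ β C₀) (R : Ed d)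
    {l : ℝ} (hl : ∀ u, IsTest u → l * ∫ x, u x ^ 2 ≤ Qf (fun x => V₁ x + V₂ (x - R)) u) :
    l * ∫ x, (φ₁ x + φ₂ (x - R)) ^ 2 ≤
      ∫ x, (V₂ (x - R) * φ₁ x + V₁ x * φ₂ (x - R)) * (φ₁ x + φ₂ (x - R)) := by
  have c1 := h1.hV
  have c2 := h2.hV
  have f1 := h1.hφ
  have f2 := h2.hφ
  have f1c := h1.hφ.continuous
  have f2c := h2.hφ.continuous
  set W : Ed d → ℝ := fun x => φ₁ x + φ₂ (x - R) with hW
  have iW : Integrable (fun x => W x ^ 2) := (W_int hd h1 h2 R).1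
  have Wc : Continuous W := by fun_prop
  have Wd : ContDiff ℝ 1 W := by fun_prop
  let M : ℕ → ℝ := fun n => ((n:ℝ) + 1) ^ 2
  let ψ : ℕ → Ed d → ℝ := fun n x => eta (‖x - 0‖ ^ 2 / M n)
  have M1 : ∀ n, 1 ≤ M n := fun n => (cn n).2.2
  have ψd : ∀ n, ContDiff ℝ 1 (ψ n) := fun n => by
    have h0 : ContDiff ℝ 1 (fun x : Ed d => ‖x - 0‖ ^ 2 / M n) :=
      (((contDiff_id.sub contDiff_const).norm_sq ℝ)).div_const _
    exact (eta_cd (n := 1)).comp h0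
  have ψs : ∀ n, HasCompactSupport (ψ n) := fun n => by
    refine HasCompactSupport.intro (isCompact_closedBall (0 : Ed d) (2 * M n)) fun y hy => ?_
    have hy' : 2 * M n < ‖y‖ := by simpa using hy
    refine eta_zero ?_
    rw [sub_zero, le_div_iff₀ (by linarith [M1 n])]
    nlinarith [M1 n]
  obtain ⟨B, hB, hB1, -⟩ := eta_bd
  have ψg : ∀ n x, gradient (ψ n) x = (2 * (eta1 (‖x - 0‖ ^ 2 / M n) / M n)) • (x - 0) := fun n x =>
    radial_grad 0 x (eta_div_deriv (M n) (‖x - 0‖ ^ 2))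
  have ψ1 : ∀ x : Ed d, ∀ᶠ n in atTop, ‖x - 0‖ ^ 2 / M n < 1 := fun x => by
    filter_upwards [Mn_top.eventually_gt_atTop (‖x - 0‖ ^ 2)] with n hn
    rw [div_lt_one (by linarith [M1 n])]; exact hn
  have ψgb : ∀ n x, ‖gradient (ψ n) x‖ ^ 2 ≤ 8 * B ^ 2 := fun n x => by
    have hM := M1 n
    rw [ψg, norm_smul, mul_pow, Real.norm_eq_abs, sq_abs]
    by_cases hx : ‖x - 0‖ ^ 2 / M n ∈ Set.Icc (1:ℝ) 2
    · have h2 := hx.2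
      have b1 : eta1 (‖x - 0‖ ^ 2 / M n) ^ 2 ≤ B ^ 2 := by
        rw [← sq_abs]; gcongr; exact hB1 _
      calc _ = 4 * eta1 (‖x - 0‖ ^ 2 / M n) ^ 2 * (‖x - 0‖ ^ 2 / M n) / M n := by field_simp; ring
        _ ≤ 4 * B ^ 2 * 2 / M n := by gcongr
        _ ≤ 4 * B ^ 2 * 2 := div_le_self (by positivity) hM
        _ = _ := by ring
    · rw [eta1_zero hx]; simp; positivity
  have step : ∀ n, l * ∫ x, (W x * ψ n x) ^ 2 ≤ (∫ x, W x ^ 2 * ‖gradient (ψ n) x‖ ^ 2)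
      + ∫ x, (V₂ (x - R) * φ₁ x + V₁ x * φ₂ (x - R)) * (W x * ψ n x ^ 2) := fun n => by
    rw [← Q_id h1 h2 R (ψd n) (ψs n)]
    exact energy_C1 (by fun_prop) hl (Wd.mul (ψd n)) (ψs n).mul_left
  have ψ01 : ∀ n x, 0 ≤ ψ n x ^ 2 ∧ ψ n x ^ 2 ≤ 1 := fun n x =>
    ⟨sq_nonneg _, pow_le_one₀ (eta_nonneg _) (eta_le _)⟩
  have ψl : ∀ x, Tendsto (fun n => ψ n x) atTop (𝓝 1) := fun x => by
    refine tendsto_const_nhds.congr' ?_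
    filter_upwards [ψ1 x] with n hn
    exact (eta_one hn.le).symm
  have T1 : Tendsto (fun n => ∫ x, (W x * ψ n x) ^ 2) atTop (𝓝 (∫ x, W x ^ 2)) := by
    refine tendsto_integral_of_dominated_convergence (fun x => W x ^ 2) ?_ iW ?_ ?_
    · intro n; have := (ψd n).continuous; exact Continuous.aestronglyMeasurable (by fun_prop)
    · refine fun n => ae_of_all _ fun x => ?_
      rw [Real.norm_of_nonneg (sq_nonneg _), mul_pow]
      exact mul_le_of_le_one_right (sq_nonneg _) (ψ01 n x).2
    · refine ae_of_all _ fun x => ?_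
      simpa using ((ψl x).const_mul (W x)).pow 2
  have T2 : Tendsto (fun n => ∫ x, W x ^ 2 * ‖gradient (ψ n) x‖ ^ 2) atTop (𝓝 (∫ x : Ed d, (0:ℝ))) := by
    refine tendsto_integral_of_dominated_convergence (fun x => W x ^ 2 * (8 * B ^ 2)) ?_ (iW.mul_const _) ?_ ?_
    · intro n; have := cont_grad (ψd n); exact Continuous.aestronglyMeasurable (by fun_prop)
    · refine fun n => ae_of_all _ fun x => ?_
      rw [Real.norm_of_nonneg (by positivity)]
      gcongr; exact ψgb n x
    · refine ae_of_all _ fun x => ?_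
      refine tendsto_const_nhds.congr' ?_
      filter_upwards [ψ1 x] with n hn
      rw [ψg, eta1_zero (fun h => absurd h.1 (by linarith))]; simp
  have T3 : Tendsto (fun n => ∫ x, (V₂ (x - R) * φ₁ x + V₁ x * φ₂ (x - R)) * (W x * ψ n x ^ 2)) atTop
      (𝓝 (∫ x, (V₂ (x - R) * φ₁ x + V₁ x * φ₂ (x - R)) * W x)) := by
    refine tendsto_integral_of_dominated_convergence (fun x => C₀ * W x ^ 2) ?_ (iW.const_mul _) ?_ ?_
    · intro n; have := (ψd n).continuous; exact Continuous.aestronglyMeasurable (by fun_prop)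
    · refine fun n => ae_of_all _ fun x => ?_
      have p1 := h1.pos x
      have p2 := h2.pos (x - R)
      have hWp : 0 < W x := add_pos p1 p2
      have hC := h1.hC
      have b0 : |V₂ (x - R) * φ₁ x + V₁ x * φ₂ (x - R)| ≤ C₀ * W x := by
        refine (abs_add_le _ _).trans ?_
        rw [abs_mul, abs_mul, abs_of_pos p1, abs_of_pos p2, hW, mul_add]
        gcongr
        · exact h2.Vbd hd _
        · exact h1.Vbd hd _
      rw [norm_mul, Real.norm_eq_abs, Real.norm_of_nonneg (mul_nonneg hWp.le (ψ01 n x).1)]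
      calc _ ≤ (C₀ * W x) * (W x * 1) := by
            refine mul_le_mul b0 ?_ (mul_nonneg hWp.le (ψ01 n x).1) (by positivity)
            exact mul_le_mul_of_nonneg_left (ψ01 n x).2 hWp.le
        _ = _ := by ring
    · refine ae_of_all _ fun x => ?_
      simpa using ((((ψl x).pow 2).const_mul (W x)).const_mul (V₂ (x - R) * φ₁ x + V₁ x * φ₂ (x - R)))
  have T4 := T2.add T3
  rw [integral_zero, zero_add] at T4
  exact le_of_tendsto_of_tendsto' (T1.const_mul l) T4 step

lemma pos_sq {V φ : Ed d → ℝ} {β C₀ : ℝ} (hd : 5 ≤ d) (h : GS V φ β C₀) : 0 < ∫ x, φ x ^ 2 := by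
  rw [integral_pos_iff_support_of_nonneg (fun x => sq_nonneg _) (h.sq_int hd)]
  have : Function.support (fun x => φ x ^ 2) = Set.univ := by
    ext x; simp [(h.pos x).ne']
  rw [this]
  exact isOpen_univ.measure_pos volume ⟨0, trivial⟩


end Aux

theorem stmt6 (d : ℕ) (hd : 5 ≤ d) (V₁ V₂ : Ed d → ℝ)
    (h1c : Continuous V₁) (h2c : Continuous V₂)
    (β C₀ : ℝ) (hβ : (d : ℝ) - 2 < β) (hC₀ : 0 < C₀)
    (h1b : ∀ x : Ed d, |V₁ x| ≤ C₀ * (1 + ‖x‖ ^ 2) ^ (-β / 2))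
    (h2b : ∀ x : Ed d, |V₂ x| ≤ C₀ * (1 + ‖x‖ ^ 2) ^ (-β / 2))
    (h1cr : Crit V₁) (h2cr : Crit V₂) :
    ∃ r₀ : ℝ, 0 < r₀ ∧
      (∀ R : Ed d, r₀ ≤ ‖R‖ → Supercrit (fun x => V₁ x + V₂ (x - R))) ∧
      ∃ C : ℝ, 0 < C ∧ ∀ R : Ed d, r₀ ≤ ‖R‖ →
        -C * ‖R‖ ^ ((2 : ℝ) - d) ≤ Energy (fun x => V₁ x + V₂ (x - R)) ∧
        Energy (fun x => V₁ x + V₂ (x - R)) ≤ -C⁻¹ * ‖R‖ ^ ((2 : ℝ) - d) := by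
  obtain ⟨φ₁, h1⟩ := GS.of hd h1c hβ hC₀ h1b h1cr
  obtain ⟨φ₂, h2⟩ := GS.of hd h2c hβ hC₀ h2b h2cr
  obtain ⟨A, hA, lo⟩ := E_lower hd h1 h2
  obtain ⟨m, hm, r, hr, up⟩ := NW_lim hd h1 h2
  set D := 2 * (∫ x, φ₁ x ^ 2) + 2 * ∫ x, φ₂ x ^ 2 with hD
  have D0 : 0 < D := by
    have := pos_sq hd h1
    have := pos_sq hd h2
    positivity
  have ub : ∀ R : Ed d, r ≤ ‖R‖ → ∀ l : ℝ,
      (∀ u, IsTest u → l * ∫ x, u x ^ 2 ≤ Qf (fun x => V₁ x + V₂ (x - R)) u) → l ≤ -(m / D) * ‖R‖ ^ ((2 : ℝ) - d) := by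
    intro R hR l hl
    have hR0 : 0 < ‖R‖ := by linarith
    have s0 : 0 < ‖R‖ ^ ((2 : ℝ) - d) := by positivity
    have a := (E_test hd h1 h2 R hl).trans (up R hR)
    obtain ⟨-, b⟩ := W_int hd h1 h2 R
    have b0 : 0 ≤ ∫ x, (φ₁ x + φ₂ (x - R)) ^ 2 := integral_nonneg fun x => sq_nonneg _
    set s := ‖R‖ ^ ((2 : ℝ) - d)
    set I := ∫ x, (φ₁ x + φ₂ (x - R)) ^ 2
    have ms : 0 < m * s := by positivity
    have lneg : l < 0 := by
      by_contra! hl0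
      have := mul_nonneg hl0 b0
      linarith
    have k : l * D ≤ l * I := mul_le_mul_of_nonpos_left b lneg.le
    have : l * D ≤ -m * s := by linarith
    calc l = l * D / D := by field_simp
      _ ≤ -m * s / D := by gcongr
      _ = _ := by ring
  refine ⟨r, hr, fun R hR => ?_, max A (D / m), lt_max_of_lt_left hA, fun R hR => ?_⟩
  · by_contra hn
    unfold Supercrit at hn
    push Not at hn
    have := ub R hR 0 (fun u hu => by rw [zero_mul]; exact hn u hu)
    have hR0 : 0 < ‖R‖ := by linarith
    have s0 : 0 < ‖R‖ ^ ((2 : ℝ) - d) := by positivity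
    have : 0 < m / D * ‖R‖ ^ ((2 : ℝ) - d) := by positivity
    linarith
  · have hR0 : 0 < ‖R‖ := by linarith
    have s0 : 0 < ‖R‖ ^ ((2 : ℝ) - d) := by positivity
    have mem : (-A * ‖R‖ ^ ((2:ℝ) - d)) ∈ {l : ℝ | ∀ u, IsTest u → l * ∫ x, u x ^ 2 ≤ Qf (fun x => V₁ x + V₂ (x - R)) u} := lo R hR0
    constructor
    · refine le_trans ?_ (le_csSup ⟨_, fun l hl => ub R hR l hl⟩ mem)
      have := le_max_left A (D / m)
      have := mul_le_mul_of_nonneg_right this s0.le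
      linarith
    · refine (csSup_le ⟨_, mem⟩ fun l hl => ub R hR l hl).trans ?_
      have h := le_max_right A (D / m)
      have : (max A (D / m))⁻¹ ≤ m / D := by
        rw [← inv_div D m]
        exact inv_anti₀ (by positivity) h
      have := mul_le_mul_of_nonneg_right this s0.le
      linarith
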